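/- Let G be a finitely generated group, E an admissible family of subgroups of G, and T a minimal E-tree in which every vertex has valence at least 3. Let Y be a cylinder with |∂Y| ≥ 4. Then for all u ≠ v in ∂Y, the non-peripheral cross-connected component based on Y is represented by a special forest S such that u ∈ S and v ∈ S*. -/

import Mathlib

open scoped Pointwise symmDiff

namespace SSRN

section Group
variable {G : Type*} [Group G]

/-- A subset of `G` is `H`-finite if it is contained in finitely many orbits of the
action of `H` on `G` by left multiplication. -/
def HFin (H : Subgroup G) (X : Set G) : Prop :=
  ∃ F : Finset G, X ⊆ ⋃ f ∈ F, (· * f) '' (H : Set G)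

/-- Two subsets of `G` are `H`-equivalent if their symmetric difference is `H`-finite. -/
def AIEquiv (H : Subgroup G) (X Y : Set G) : Prop := HFin H (X ∆ Y)

/-- `X` is an `H`-almost invariant subset of `G`. -/
def IsAI (H : Subgroup G) (X : Set G) : Prop :=
  (∀ h ∈ H, (h * ·) '' X = X) ∧ ∀ s : G, HFin H (((· * s) '' X) ∆ X)

/-- `X` is a non-trivial `H`-almost invariant subset of `G`. -/
def NontrivAI (H : Subgroup G) (X : Set G) : Prop :=
  IsAI H X ∧ ¬ HFin H X ∧ ¬ HFin H Xᶜ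

/-- The `H`-almost invariant set `X` crosses `Y`: none of the four corners is `H`-finite. -/
def Crosses (H : Subgroup G) (X Y : Set G) : Prop :=
  ¬ HFin H (X ∩ Y) ∧ ¬ HFin H (X ∩ Yᶜ) ∧ ¬ HFin H (Xᶜ ∩ Y) ∧ ¬ HFin H (Xᶜ ∩ Yᶜ)

/-- Crossing of (non-trivial) almost invariant sets, quantifying over the groups over
which they are almost invariant. -/
def CrossesAny (X X' : Set G) : Prop :=
  ∃ H K : Subgroup G, NontrivAI H X ∧ NontrivAI K X' ∧ Crosses H X X'

/-- `X` and `X'` determine the same unordered pair `{[X], [X*]}` of equivalence classes. -/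
def SamePair (X X' : Set G) : Prop :=
  ∃ H : Subgroup G, NontrivAI H X ∧ (HFin H (X ∆ X') ∨ HFin H (X ∆ X'ᶜ))

/-- An admissible family of subgroups: conjugacy invariant, closed under commensurability,
and no member contains another with infinite index. -/
def Admissible (E : Set (Subgroup G)) : Prop :=
  (∀ H ∈ E, ∀ g : G, (MulAut.conj g • H) ∈ E) ∧
  (∀ H ∈ E, ∀ K : Subgroup G, Subgroup.Commensurable K H → K ∈ E) ∧
  (∀ A ∈ E, ∀ B ∈ E, A ≤ B → A.relIndex B ≠ 0)

end Group

section Tree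

variable {V : Type*}

/-- The stabilizer of an edge `e : Sym2 V` under the action of `G`. -/
def edgeStab (G : Type*) [Group G] [MulAction G V] (e : Sym2 V) : Subgroup G where
  carrier := {g | Sym2.map (g • ·) e = e}
  one_mem' := by
    show Sym2.map ((1 : G) • ·) e = e
    have : ((1 : G) • · : V → V) = id := by funext v; simp
    rw [this, Sym2.map_id]; rfl
  mul_mem' := by
    intro a b ha hb
    show Sym2.map ((a * b) • ·) e = e
    have : ((a * b) • · : V → V) = (a • ·) ∘ (b • ·) := by funext v; simp [mul_smul]
    rw [this, ← Sym2.map_map, hb, ha]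
  inv_mem' := by
    intro a ha
    show Sym2.map (a⁻¹ • ·) e = e
    conv_lhs => rw [← ha]
    rw [Sym2.map_map]
    have : ((a⁻¹ • ·) ∘ (a • ·) : V → V) = id := by funext v; simp
    rw [this, Sym2.map_id]; rfl

variable (T : SimpleGraph V)

/-- `G` acts on the graph `T` by graph automorphisms. -/
def ActsOn (G : Type*) [Group G] [MulAction G V] : Prop :=
  ∀ (g : G) (u v : V), T.Adj u v → T.Adj (g • u) (g • v)

/-- The action of `G` on `T` is without inversions. -/
def NoInversions (G : Type*) [Group G] [MulAction G V] : Prop :=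
  ∀ (g : G) (u v : V), T.Adj u v → ¬ (g • u = v ∧ g • v = u)

/-- `w` lies between `u` and `v`: it is on every path from `u` to `v`. -/
def Btw (u w v : V) : Prop := ∀ p : T.Walk u v, p.IsPath → w ∈ p.support

/-- The action of `G` on the tree `T` is minimal: every nonempty invariant subtree
(convex invariant set of vertices) is the whole vertex set. -/
def MinimalAction (G : Type*) [Group G] [MulAction G V] : Prop :=
  ∀ A : Set V, A.Nonempty → (∀ (g : G), ∀ a ∈ A, g • a ∈ A) →
    (∀ u ∈ A, ∀ v ∈ A, ∀ w : V, Btw T u w v → w ∈ A) → A = Set.univ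

/-- The action of `G` is non-trivial: there is no global fixed vertex. -/
def NontrivialAction (G : Type*) [Group G] [MulAction G V] : Prop :=
  ¬ ∃ v : V, ∀ g : G, g • v = v

/-- `T` is an `E`-tree: all edge stabilizers belong to `E`. -/
def IsETree (G : Type*) [Group G] [MulAction G V] (E : Set (Subgroup G)) : Prop :=
  ∀ e ∈ T.edgeSet, edgeStab G e ∈ E

/-- There are finitely many `G`-orbits of edges. -/
def FinEdgeOrbits (G : Type*) [Group G] [MulAction G V] : Prop :=
  ∃ F : Finset (Sym2 V), ∀ e ∈ T.edgeSet, ∃ e₀ ∈ F, ∃ g : G, Sym2.map (g • ·) e₀ = e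

/-- A cylinder of `T`: an equivalence class of edges for commensurability of stabilizers. -/
def IsCylinder (G : Type*) [Group G] [MulAction G V] (Y : Set (Sym2 V)) : Prop :=
  Y.Nonempty ∧ Y ⊆ T.edgeSet ∧
    ∀ e ∈ Y, ∀ e' ∈ T.edgeSet,
      (e' ∈ Y ↔ Subgroup.Commensurable (edgeStab G e) (edgeStab G (V := V) e'))

/-- The set of vertices of a set of edges (e.g. of a cylinder). -/
def cylVerts (Y : Set (Sym2 V)) : Set V := {v | ∃ e ∈ Y, v ∈ e}

/-- The boundary of a cylinder: its vertices lying in another cylinder,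
i.e. incident to an edge outside the cylinder. -/
def cylBoundary (Y : Set (Sym2 V)) : Set V :=
  {v | v ∈ cylVerts Y ∧ ∃ e ∈ T.edgeSet, v ∈ e ∧ e ∉ Y}

/-- `H` belongs to the commensurability class associated to the cylinder `Y`. -/
def InClassOf (G : Type*) [Group G] [MulAction G V] (Y : Set (Sym2 V)) (H : Subgroup G) : Prop :=
  ∃ e ∈ Y, Subgroup.Commensurable H (edgeStab G e)

/-- The coboundary of a set of vertices: edges with exactly one endpoint in it. -/
def cobdry (S : Set V) : Set (Sym2 V) :=
  {e | e ∈ T.edgeSet ∧ ∃ u v : V, e = s(u, v) ∧ u ∈ S ∧ v ∉ S}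

/-- `S` is a special forest based on the cylinder `Y`. -/
def IsSpecialForest (S : Set V) (Y : Set (Sym2 V)) : Prop :=
  (cobdry T S).Finite ∧ cobdry T S ⊆ Y

/-- A set of vertices is non-trivial if it is neither finite nor cofinite. -/
def NontrivForest (S : Set V) : Prop := ¬ S.Finite ∧ ¬ (Sᶜ : Set V).Finite

/-- The almost invariant set associated to a set of vertices. -/
def XS (G : Type*) [Group G] [MulAction G V] (v₀ : V) (S : Set V) : Set G :=
  {g : G | g • v₀ ∈ S}

/-- The component `T_e` of `T` minus the open edge `e = s(u,v)` containing the terminal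
vertex `v`. -/
def halfTree (u v : V) : Set V :=
  {w | ∃ p : T.Walk v w, p.IsPath ∧ s(u, v) ∉ p.edges}

/-- The almost invariant set `Z_e` dual to the oriented edge `(u, v)`. -/
def Ze (G : Type*) [Group G] [MulAction G V] (v₀ u v : V) : Set G :=
  XS G v₀ (halfTree T u v)

/-- `v` has finitely many incident edges in `Y`. -/
def FiniteValenceIn (Y : Set (Sym2 V)) (v : V) : Prop := {e | e ∈ Y ∧ v ∈ e}.Finite

/-- The peripheral special forest `S_{v,Y}`: the component of `v` in `T` minus the open
edges of `Y` incident to `v`. -/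
def periForest (Y : Set (Sym2 V)) (v : V) : Set V :=
  {w | ∃ p : T.Walk v w, p.IsPath ∧ ∀ e ∈ Y, v ∈ e → e ∉ p.edges}

/-- The peripheral almost invariant set `X_{v,Y}`. -/
def XvY (G : Type*) [Group G] [MulAction G V] (v₀ : V) (Y : Set (Sym2 V)) (v : V) : Set G :=
  XS G v₀ (periForest T Y v)

/-- A peripheral special forest: one equivalent to some `S_{v,Y}`. -/
def PeripheralForest (G : Type*) [Group G] [MulAction G V] (S : Set V) : Prop :=
  ∃ (Y : Set (Sym2 V)) (v : V), IsCylinder T G Y ∧ v ∈ cylBoundary T Y ∧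
    FiniteValenceIn Y v ∧ (S ∆ periForest T Y v).Finite

/-- The Boolean algebra `B_C(T)` of (representatives of) almost invariant sets based on the
cylinder `Y`: the smallest family containing the sets `Z_e`, `e ∈ Y`, closed under
complement, intersection and `H`-equivalence. -/
def BCT {G : Type*} [Group G] [MulAction G V] (v₀ : V) (Y : Set (Sym2 V)) (H : Subgroup G) :
    Set (Set G) :=
  ⋂₀ {F : Set (Set G) |
    (∀ u v : V, T.Adj u v → s(u, v) ∈ Y → Ze T G v₀ u v ∈ F) ∧
    (∀ X ∈ F, Xᶜ ∈ F) ∧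
    (∀ X ∈ F, ∀ X' ∈ F, X ∩ X' ∈ F) ∧
    (∀ X ∈ F, ∀ X' : Set G, HFin H (X ∆ X') → X' ∈ F)}

/-- The set `B(T)` of (representatives of) almost invariant sets based on `T`. -/
def BT (G : Type*) [Group G] [MulAction G V] (v₀ : V) : Set (Set G) :=
  {X | ∃ Y : Set (Sym2 V), IsCylinder T G Y ∧ ∃ e ∈ Y, X ∈ BCT T v₀ Y (edgeStab G e)}

/-- Elements of `B(T)` that are non-trivial almost invariant sets. -/
def NontrivB (G : Type*) [Group G] [MulAction G V] (v₀ : V) : Set (Set G) :=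
  {X | X ∈ BT T G v₀ ∧ ∃ H : Subgroup G, NontrivAI H X}

/-- One step of the relation generating cross-connected components. -/
def ccStep (G : Type*) [Group G] [MulAction G V] (v₀ : V) (X X' : Set G) : Prop :=
  X ∈ NontrivB T G v₀ ∧ X' ∈ NontrivB T G v₀ ∧ (CrossesAny X X' ∨ SamePair X X')

/-- The equivalence relation generated by crossing (and identification of equivalent sets
and complements) on `B(T)`. -/
def ccRel (G : Type*) [Group G] [MulAction G V] (v₀ : V) : Set G → Set G → Prop :=
  Relation.EqvGen (ccStep T G v₀)

/-- The cross-connected component of (the pair determined by) `X`. -/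
def ccOf (G : Type*) [Group G] [MulAction G V] (v₀ : V) (X : Set G) : Set (Set G) :=
  {X' | ccRel T G v₀ X X'}

/-- `C` is a cross-connected component of `B(T)`. -/
def IsCCC (G : Type*) [Group G] [MulAction G V] (v₀ : V) (C : Set (Set G)) : Prop :=
  ∃ X ∈ NontrivB T G v₀, C = ccOf T G v₀ X

/-- A cross-connected component is based on the cylinder `Y` if its members are almost
invariant over subgroups in the commensurability class of `Y`. -/
def CCCBasedOn (G : Type*) [Group G] [MulAction G V] (Y : Set (Sym2 V)) (C : Set (Set G)) :
    Prop :=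
  ∃ X ∈ C, ∃ H : Subgroup G, InClassOf G Y H ∧ NontrivAI H X

/-- A peripheral cross-connected component. -/
def PeripheralCCC (G : Type*) [Group G] [MulAction G V] (v₀ : V) (C : Set (Set G)) : Prop :=
  ∃ (Y : Set (Sym2 V)) (v : V), IsCylinder T G Y ∧ v ∈ cylBoundary T Y ∧
    FiniteValenceIn Y v ∧ XvY T G v₀ Y v ∈ C

/-- Betweenness of (distinct) cross-connected components. -/
def CCCBetween {G : Type*} [Group G] (C₁ C₂ C₃ : Set (Set G)) : Prop :=
  C₁ ≠ C₂ ∧ C₂ ≠ C₃ ∧ C₁ ≠ C₃ ∧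
    ∃ X₁ ∈ C₁, ∃ X₂ ∈ C₂, ∃ X₃ ∈ C₃, X₁ ⊆ X₂ ∧ X₂ ⊆ X₃

/-- A star of cross-connected components. -/
def IsStar (G : Type*) [Group G] [MulAction G V] (v₀ : V) (St : Set (Set (Set G))) : Prop :=
  (∀ C ∈ St, IsCCC T G v₀ C) ∧ St.Nontrivial ∧
  (∀ C ∈ St, ∀ C' ∈ St, ∀ C'' : Set (Set G), IsCCC T G v₀ C'' → ¬ CCCBetween C C'' C') ∧
  (∀ St' : Set (Set (Set G)), St ⊆ St' → (∀ C ∈ St', IsCCC T G v₀ C) →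
    (∀ C ∈ St', ∀ C' ∈ St', ∀ C'' : Set (Set G), IsCCC T G v₀ C'' → ¬ CCCBetween C C'' C') →
    St' = St)

/-- The regular neighbourhood `RN(B(T))`: the bipartite graph on cross-connected
components and stars. -/
def RNGraph (G : Type*) [Group G] [MulAction G V] (v₀ : V) :
    SimpleGraph ({C : Set (Set G) // IsCCC T G v₀ C} ⊕
      {St : Set (Set (Set G)) // IsStar T G v₀ St}) where
  Adj x y :=
    match x, y with
    | Sum.inl C, Sum.inr St => C.1 ∈ St.1
    | Sum.inr St, Sum.inl C => C.1 ∈ St.1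
    | _, _ => False
  symm := ⟨by rintro (C | St) (C' | St') h <;> exact h⟩
  loopless := ⟨by rintro (C | St) h <;> exact h⟩

/-- Vertices of `T` lying in at least two cylinders. -/
def TcV0 (G : Type*) [Group G] [MulAction G V] : Set V :=
  {v | ∃ Y Y' : Set (Sym2 V), IsCylinder T G Y ∧ IsCylinder T G Y' ∧ Y ≠ Y' ∧
    v ∈ cylVerts Y ∧ v ∈ cylVerts Y'}

/-- The tree of cylinders `T_c` of `T`, as a bipartite graph. -/
def TcGraph (G : Type*) [Group G] [MulAction G V] :
    SimpleGraph ({v : V // v ∈ TcV0 T G} ⊕ {Y : Set (Sym2 V) // IsCylinder T G Y}) where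
  Adj x y :=
    match x, y with
    | Sum.inl v, Sum.inr Y => v.1 ∈ cylVerts Y.1
    | Sum.inr Y, Sum.inl v => v.1 ∈ cylVerts Y.1
    | _, _ => False
  symm := ⟨by rintro (v | Y) (v' | Y') h <;> exact h⟩
  loopless := ⟨by rintro (v | Y) h <;> exact h⟩


/-- `T` dominates `T'`: there is a `G`-equivariant map. -/
def Dominates (G : Type*) [Group G] {V V' : Type*} [MulAction G V] [MulAction G V']
    (T : SimpleGraph V) (T' : SimpleGraph V') : Prop :=
  ∃ f : V → V', ∀ (g : G) (x : V), f (g • x) = g • f x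

end Tree

section Subdiv

variable {α β : Type*}

/-- `S` is a subdivision of `Γ` via the vertex embedding `f`. -/
def SubdivVia (f : α → β) (S : SimpleGraph β) (Γ : SimpleGraph α) : Prop :=
  Function.Injective f ∧
  (∀ b : β, b ∉ Set.range f → ∃ x y : β, x ≠ y ∧ S.neighborSet b = {x, y}) ∧
  (∀ u : α, Nonempty (Γ.neighborSet u ≃ S.neighborSet (f u))) ∧
  (∀ u v : α, Γ.Adj u v ↔ ∃ p : S.Walk (f u) (f v), p.IsPath ∧ 1 ≤ p.length ∧
      ∀ w ∈ p.support, w ∈ Set.range f → w = f u ∨ w = f v) ∧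
  (∀ e ∈ S.edgeSet, ∃ (u v : α) (p : S.Walk (f u) (f v)), Γ.Adj u v ∧ p.IsPath ∧
      (∀ w ∈ p.support, w ∈ Set.range f → w = f u ∨ w = f v) ∧ e ∈ p.edges)

/-- `S` is (isomorphic to) a subdivision of `Γ`. -/
def IsSubdivision (S : SimpleGraph β) (Γ : SimpleGraph α) : Prop :=
  ∃ f : α → β, SubdivVia f S Γ

end Subdiv

end SSRN

namespace SSRN

section TreeLemmas

variable {V : Type*} {T : SimpleGraph V}

open SimpleGraph

theorem mem_halfTree {x y w : V} : w ∈ halfTree T x y ↔ ∃ p : T.Walk y w, s(x, y) ∉ p.edges := by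
  classical
  constructor
  · rintro ⟨p, _, h⟩
    exact ⟨p, h⟩
  · rintro ⟨p, h⟩
    exact ⟨p.bypass, p.bypass_isPath, fun h' => h (p.edges_bypass_subset_edges h')⟩

theorem self_mem_halfTree (x y : V) : y ∈ halfTree T x y :=
  mem_halfTree.2 ⟨Walk.nil, by simp⟩

theorem halfTree_step {x y a b : V} (ha : a ∈ halfTree T x y) (hab : T.Adj a b)
    (hne : s(a, b) ≠ s(x, y)) : b ∈ halfTree T x y := by
  obtain ⟨p, hp⟩ := mem_halfTree.1 ha
  refine mem_halfTree.2 ⟨p.append (Walk.cons hab Walk.nil), ?_⟩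
  simp only [Walk.edges_append, Walk.edges_cons, Walk.edges_nil, List.mem_append,
    List.mem_singleton, not_or]
  exact ⟨hp, fun h => hne h.symm⟩

theorem not_mem_both (hT : T.IsTree) {x y w : V} (hxy : T.Adj x y)
    (h1 : w ∈ halfTree T x y) (h2 : w ∈ halfTree T y x) : False := by
  obtain ⟨p, hp⟩ := mem_halfTree.1 h1
  obtain ⟨q, hq⟩ := mem_halfTree.1 h2
  have hb := isAcyclic_iff_forall_isBridge.1 hT.isAcyclic (e := s(x, y)) hxy
  have := isBridge_iff_forall_walk_mem_edges.1 hb (q.append p.reverse)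
  simp only [Walk.edges_append, Walk.edges_reverse, List.mem_append, List.mem_reverse] at this
  rcases this with h | h
  · rw [Sym2.eq_swap] at h; exact hq h
  · exact hp h

theorem mem_or_mem (hT : T.IsTree) (x y w : V) :
    w ∈ halfTree T x y ∨ w ∈ halfTree T y x := by
  obtain ⟨p⟩ := hT.connected.preconnected y w
  by_contra hcon
  obtain ⟨d, -, h1, h2⟩ := p.exists_boundary_dart (halfTree T x y ∪ halfTree T y x)
    (Or.inl (self_mem_halfTree x y)) hcon
  apply h2
  by_cases he : s(d.fst, d.snd) = s(x, y)
  · rcases Sym2.eq_iff.1 he with ⟨_, h⟩ | ⟨_, h⟩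
    · rw [h]; exact Or.inl (self_mem_halfTree x y)
    · rw [h]; exact Or.inr (self_mem_halfTree y x)
  · rcases h1 with h1 | h1
    · exact Or.inl (halfTree_step h1 d.adj he)
    · exact Or.inr (halfTree_step h1 d.adj (by rwa [Sym2.eq_swap (a := y)]))

theorem compl_halfTree (hT : T.IsTree) {x y : V} (hxy : T.Adj x y) :
    (halfTree T x y)ᶜ = halfTree T y x := by
  ext w
  constructor
  · intro h
    exact (mem_or_mem hT x y w).resolve_left h
  · intro h h'
    exact not_mem_both hT hxy h' h

theorem not_self_mem (hT : T.IsTree) {x y : V} (hxy : T.Adj x y) : x ∉ halfTree T x y :=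
  fun h => not_mem_both hT hxy h (self_mem_halfTree y x)

theorem mem_cobdry_of {S : Set V} {a b : V} (hab : T.Adj a b) (ha : a ∈ S) (hb : b ∉ S) :
    s(a, b) ∈ cobdry T S := ⟨hab, a, b, rfl, ha, hb⟩

theorem cobdry_halfTree (hT : T.IsTree) {x y : V} (hxy : T.Adj x y) :
    cobdry T (halfTree T x y) = {s(x, y)} := by
  ext e
  constructor
  · rintro ⟨he, a, b, rfl, ha, hb⟩
    by_contra hne
    exact hb (halfTree_step ha he hne)
  · rintro rfl
    rw [Sym2.eq_swap]
    exact mem_cobdry_of hxy.symm (self_mem_halfTree x y) (not_self_mem hT hxy)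

theorem cobdry_compl (S : Set V) : cobdry T Sᶜ = cobdry T S := by
  ext e
  constructor
  · rintro ⟨he, a, b, rfl, ha, hb⟩
    exact ⟨he, b, a, Sym2.eq_swap, not_not.1 hb, ha⟩
  · rintro ⟨he, a, b, rfl, ha, hb⟩
    exact ⟨he, b, a, Sym2.eq_swap, hb, fun h => h ha⟩

theorem cobdry_inter_subset (S R : Set V) : cobdry T (S ∩ R) ⊆ cobdry T S ∪ cobdry T R := by
  rintro e ⟨he, a, b, rfl, ha, hb⟩
  by_cases h : b ∈ S
  · exact Or.inr ⟨he, a, b, rfl, ha.2, fun h' => hb ⟨h, h'⟩⟩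
  · exact Or.inl ⟨he, a, b, rfl, ha.1, h⟩

theorem mem_cobdry_mk {S : Set V} {a b : V} :
    s(a, b) ∈ cobdry T S ↔ T.Adj a b ∧ ¬ (a ∈ S ↔ b ∈ S) := by
  constructor
  · rintro ⟨he, c, d, h, hc, hd⟩
    refine ⟨he, ?_⟩
    rcases Sym2.eq_iff.1 h with ⟨rfl, rfl⟩ | ⟨rfl, rfl⟩ <;> tauto
  · rintro ⟨he, h⟩
    by_cases ha : a ∈ S
    · exact mem_cobdry_of he ha (by tauto)
    · rw [Sym2.eq_swap]
      exact mem_cobdry_of he.symm (by tauto) ha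

theorem cobdry_symmDiff (S R : Set V) : cobdry T (S ∆ R) = cobdry T S ∆ cobdry T R := by
  ext e
  induction e with
  | _ a b =>
    simp only [Set.mem_symmDiff, mem_cobdry_mk]
    tauto

/-- every walk leaving `S` uses a coboundary edge -/
theorem exists_cobdry_edge {S : Set V} {a b : V} (p : T.Walk a b) (ha : a ∈ S) (hb : b ∉ S) :
    ∃ c d, T.Adj c d ∧ s(c, d) ∈ p.edges ∧ c ∈ S ∧ d ∉ S ∧ s(c, d) ∈ cobdry T S := by
  obtain ⟨d, hd, h1, h2⟩ := p.exists_boundary_dart S ha hb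
  refine ⟨d.fst, d.snd, d.adj, ?_, h1, h2, mem_cobdry_of d.adj h1 h2⟩
  exact List.mem_map_of_mem (f := Dart.edge) hd

theorem halfTree_walk_support {x y w : V} (p : T.Walk y w) (h : s(x, y) ∉ p.edges) {z : V}
    (hz : z ∈ p.support) : z ∈ halfTree T x y := by
  classical
  exact mem_halfTree.2 ⟨p.takeUntil z hz, fun h' => h (p.edges_takeUntil_subset_edges hz h')⟩

theorem halfTree_subset_of {S : Set V} {x y : V} (hy : y ∈ S)
    (h : ∀ a b, T.Adj a b → a ∈ halfTree T x y → b ∈ halfTree T x y → a ∈ S → b ∈ S) :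
    halfTree T x y ⊆ S := by
  intro w hw
  obtain ⟨p, hp⟩ := mem_halfTree.1 hw
  by_contra hwS
  obtain ⟨c, d, hcd, he, hc, hd, -⟩ := exists_cobdry_edge p hy hwS
  exact hd (h c d hcd (halfTree_walk_support p hp (p.fst_mem_support_of_mem_edges he))
    (halfTree_walk_support p hp (p.snd_mem_support_of_mem_edges he)) hc)

theorem halfTree_subset_halfTree (hT : T.IsTree) {x y z : V} (hxy : T.Adj x y) (hyz : T.Adj y z)
    (hne : x ≠ z) : halfTree T y z ⊆ halfTree T x y := by
  apply halfTree_subset_of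
  · apply halfTree_step (self_mem_halfTree x y) hyz
    intro h
    rcases Sym2.eq_iff.1 h with ⟨h, _⟩ | ⟨_, h⟩
    · exact hxy.ne h.symm
    · exact hne h.symm
  · intro a b hab ha hb haS
    refine halfTree_step haS hab ?_
    intro h
    rcases Sym2.eq_iff.1 h with ⟨_, rfl⟩ | ⟨rfl, _⟩
    · exact not_self_mem hT hyz hb
    · exact not_self_mem hT hyz ha

theorem halfTree_disjoint (hT : T.IsTree) {y a b w : V} (ha : T.Adj y a) (hb : T.Adj y b)
    (hne : a ≠ b) (h1 : w ∈ halfTree T y a) (h2 : w ∈ halfTree T y b) : False :=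
  not_mem_both hT hb.symm (halfTree_subset_halfTree hT hb.symm ha hne.symm h1) h2

/-- Convexity of half trees. -/
theorem halfTree_convex {x y a b w : V} (ha : a ∈ halfTree T x y) (hb : b ∈ halfTree T x y)
    (hw : Btw T a w b) : w ∈ halfTree T x y := by
  classical
  obtain ⟨p, hp⟩ := mem_halfTree.1 ha
  obtain ⟨q, hq⟩ := mem_halfTree.1 hb
  have h1 := hw (p.reverse.append q).bypass (Walk.bypass_isPath _)
  have h2 := (Walk.support_bypass_subset_support _) h1
  rw [Walk.mem_support_append_iff, Walk.support_reverse, List.mem_reverse] at h2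
  rcases h2 with h2 | h2
  · exact halfTree_walk_support p hp h2
  · exact halfTree_walk_support q hq h2

/-- Special forests: induction principle. -/
theorem special_induction (hT : T.IsTree) {Y : Set (Sym2 V)} {P : Set V → Prop}
    (h0 : P ∅) (h1 : P Set.univ)
    (h2 : ∀ S x y, P S → T.Adj x y → s(x, y) ∈ Y → P (S ∆ halfTree T x y))
    (S : Set V) (hS : IsSpecialForest T S Y) : P S := by
  obtain ⟨n, hn⟩ : ∃ n, (cobdry T S).ncard = n := ⟨_, rfl⟩
  induction n generalizing S with
  | zero =>
    have hemp : cobdry T S = ∅ := (Set.ncard_eq_zero hS.1).1 hn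
    rcases S.eq_empty_or_nonempty with rfl | ⟨a, ha⟩
    · exact h0
    · have : S = Set.univ := by
        ext b
        simp only [Set.mem_univ, iff_true]
        by_contra hb
        obtain ⟨p⟩ := hT.connected.preconnected a b
        obtain ⟨c, d, -, -, -, -, h⟩ := exists_cobdry_edge p ha hb
        rw [hemp] at h
        exact h
      rw [this]; exact h1
  | succ n ih =>
    have hne : (cobdry T S).Nonempty := by
      rw [← Set.ncard_pos hS.1]; omega
    obtain ⟨e, he⟩ := hne
    obtain ⟨hadj, x, y, rfl, hx, hy⟩ := id he
    have hxy : T.Adj x y := hadj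
    have hcob : cobdry T (S ∆ halfTree T x y) = cobdry T S \ {s(x, y)} := by
      rw [cobdry_symmDiff, cobdry_halfTree hT hxy]
      ext f
      simp only [Set.mem_symmDiff, Set.mem_singleton_iff, Set.mem_sdiff]
      constructor
      · rintro (h | ⟨rfl, h⟩)
        · exact h
        · exact absurd he h
      · exact Or.inl
    have := ih (S ∆ halfTree T x y) ⟨by rw [hcob]; exact hS.1.subset Set.sdiff_subset,
      by rw [hcob]; exact Set.sdiff_subset.trans hS.2⟩
      (by rw [hcob, Set.ncard_sdiff_singleton_of_mem he]; omega)
    have h3 := h2 _ x y this hxy (hS.2 he)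
    rwa [symmDiff_symmDiff_cancel_right] at h3

theorem special_compl {S : Set V} {Y : Set (Sym2 V)} (h : IsSpecialForest T S Y) :
    IsSpecialForest T Sᶜ Y := by
  unfold IsSpecialForest
  rw [cobdry_compl]; exact h

theorem special_inter {S R : Set V} {Y : Set (Sym2 V)} (h : IsSpecialForest T S Y)
    (h' : IsSpecialForest T R Y) : IsSpecialForest T (S ∩ R) Y :=
  ⟨(h.1.union h'.1).subset (cobdry_inter_subset S R),
    (cobdry_inter_subset S R).trans (Set.union_subset h.2 h'.2)⟩

theorem special_union {S R : Set V} {Y : Set (Sym2 V)} (h : IsSpecialForest T S Y)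
    (h' : IsSpecialForest T R Y) : IsSpecialForest T (S ∪ R) Y := by
  have := special_compl (special_inter (special_compl h) (special_compl h'))
  rwa [Set.compl_inter, compl_compl, compl_compl] at this

theorem special_diff {S R : Set V} {Y : Set (Sym2 V)} (h : IsSpecialForest T S Y)
    (h' : IsSpecialForest T R Y) : IsSpecialForest T (S \ R) Y :=
  special_inter h (special_compl h')

theorem special_halfTree (hT : T.IsTree) {Y : Set (Sym2 V)} {x y : V} (hxy : T.Adj x y)
    (h : s(x, y) ∈ Y) : IsSpecialForest T (halfTree T x y) Y := by
  unfold IsSpecialForest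
  rw [cobdry_halfTree hT hxy]
  exact ⟨Set.finite_singleton _, by simpa using h⟩

theorem special_step {S : Set V} {Y : Set (Sym2 V)} (hS : IsSpecialForest T S Y) {a b : V}
    (hab : T.Adj a b) (h : s(a, b) ∉ Y) (ha : a ∈ S) : b ∈ S := by
  by_contra hb
  exact h (hS.2 (mem_cobdry_of hab ha hb))

end TreeLemmas

section GroupLemmas

variable {G : Type*} [Group G]

theorem mem_HFin_iff {H : Subgroup G} {X : Set G} :
    HFin H X ↔ ∃ F : Finset G, ∀ x ∈ X, ∃ f ∈ F, x * f⁻¹ ∈ H := by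
  constructor
  · rintro ⟨F, hF⟩
    refine ⟨F, fun x hx => ?_⟩
    have := hF hx
    simp only [Set.mem_iUnion, Set.mem_image, SetLike.mem_coe] at this
    obtain ⟨f, hf, h, hh, rfl⟩ := this
    exact ⟨f, hf, by simpa using hh⟩
  · rintro ⟨F, hF⟩
    refine ⟨F, fun x hx => ?_⟩
    obtain ⟨f, hf, h⟩ := hF x hx
    simp only [Set.mem_iUnion, Set.mem_image, SetLike.mem_coe]
    exact ⟨f, hf, x * f⁻¹, h, by simp⟩

theorem HFin.mono {H : Subgroup G} {X X' : Set G} (h : HFin H X') (hs : X ⊆ X') : HFin H X := by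
  obtain ⟨F, hF⟩ := h
  exact ⟨F, hs.trans hF⟩

theorem HFin_empty (H : Subgroup G) : HFin H ∅ := ⟨∅, by simp⟩

theorem HFin.union {H : Subgroup G} {X X' : Set G} (h : HFin H X) (h' : HFin H X') :
    HFin H (X ∪ X') := by
  classical
  rw [mem_HFin_iff] at *
  obtain ⟨F, hF⟩ := h
  obtain ⟨F', hF'⟩ := h'
  refine ⟨F ∪ F', ?_⟩
  rintro x (hx | hx)
  · obtain ⟨f, hf, h⟩ := hF x hx
    exact ⟨f, Finset.mem_union_left _ hf, h⟩
  · obtain ⟨f, hf, h⟩ := hF' x hx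
    exact ⟨f, Finset.mem_union_right _ hf, h⟩

theorem HFin_biUnion {ι : Type*} {H : Subgroup G} {A : Set ι} (hA : A.Finite) {X : ι → Set G}
    (h : ∀ i ∈ A, HFin H (X i)) : HFin H (⋃ i ∈ A, X i) := by
  induction A, hA using Set.Finite.induction_on with
  | empty => simpa using HFin_empty H
  | insert ha hs ih =>
    rw [Set.biUnion_insert]
    exact (h _ (Set.mem_insert _ _)).union (ih fun i hi => h i (Set.mem_insert_of_mem _ hi))

theorem HFin.mul_right {H : Subgroup G} {X : Set G} (h : HFin H X) (s : G) :
    HFin H ((· * s) '' X) := by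
  classical
  rw [mem_HFin_iff] at *
  obtain ⟨F, hF⟩ := h
  refine ⟨F.image (· * s), ?_⟩
  rintro _ ⟨x, hx, rfl⟩
  obtain ⟨f, hf, h⟩ := hF x hx
  exact ⟨f * s, Finset.mem_image_of_mem _ hf, by simpa [mul_assoc] using h⟩

theorem HFin.trans {H K : Subgroup G} {X : Set G} (h : HFin H X) (hK : HFin K (H : Set G)) :
    HFin K X := by
  obtain ⟨F, hF⟩ := h
  refine HFin.mono ?_ hF
  exact HFin_biUnion (A := (F : Set G)) F.finite_toSet fun f _ => hK.mul_right f

theorem HFin_of_relIndex {H K : Subgroup G} (h : H.relIndex K ≠ 0) : HFin H (K : Set G) := by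
  classical
  rw [mem_HFin_iff]
  have : (H.subgroupOf K).FiniteIndex := ⟨h⟩
  have hfin : Finite (K ⧸ H.subgroupOf K) := inferInstance
  have := Fintype.ofFinite (K ⧸ H.subgroupOf K)
  refine ⟨Finset.univ.image fun q : K ⧸ H.subgroupOf K => ((q.out : K) : G)⁻¹, ?_⟩
  intro k hk
  refine ⟨_, Finset.mem_image_of_mem _ (Finset.mem_univ
    (QuotientGroup.mk (⟨k, hk⟩ : K)⁻¹ : K ⧸ H.subgroupOf K)), ?_⟩
  have h1 := QuotientGroup.out_eq' (QuotientGroup.mk (⟨k, hk⟩ : K)⁻¹ : K ⧸ H.subgroupOf K)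
  have h2 := QuotientGroup.eq.1 h1.symm
  rw [Subgroup.mem_subgroupOf] at h2
  simpa using h2

theorem relIndex_of_HFin {H K : Subgroup G} {g : G} (h : HFin H ((· * g) '' (K : Set G))) :
    H.relIndex K ≠ 0 := by
  have h' : HFin H (K : Set G) := by
    refine (h.mul_right g⁻¹).mono ?_
    intro k hk
    exact ⟨k * g, ⟨k, hk, rfl⟩, by simp⟩
  rw [mem_HFin_iff] at h'
  obtain ⟨F, hF⟩ := h'
  have key : ∀ q : K ⧸ H.subgroupOf K, ∃ f : F, ((q.out : K) : G)⁻¹ * (f : G)⁻¹ ∈ H := by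
    intro q
    obtain ⟨f, hf, h⟩ := hF _ (K.inv_mem q.out.2)
    exact ⟨⟨f, hf⟩, h⟩
  choose φ hφ using key
  have hinj : Function.Injective φ := by
    intro q q' hq
    have h1 := hφ q
    have h2 := hφ q'
    rw [hq] at h1
    have h3 := H.mul_mem h1 (H.inv_mem h2)
    rw [← QuotientGroup.out_eq' q, ← QuotientGroup.out_eq' q']
    apply QuotientGroup.eq.2
    rw [Subgroup.mem_subgroupOf]
    simpa [mul_assoc] using h3
  have : Finite (K ⧸ H.subgroupOf K) := Finite.of_injective φ hinj
  exact Subgroup.index_ne_zero_of_finite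

theorem Comm_HFin {H K : Subgroup G} (h : Subgroup.Commensurable H K) {X : Set G} :
    HFin H X ↔ HFin K X :=
  ⟨fun hX => hX.trans (HFin_of_relIndex h.2), fun hX => hX.trans (HFin_of_relIndex h.1)⟩

/-- In an admissible family, a one-sided finite index gives commensurability. -/
theorem Admissible.comm {E : Set (Subgroup G)} (hE : Admissible E) {A B : Subgroup G}
    (hA : A ∈ E) (hB : B ∈ E) (h : B.relIndex A ≠ 0) : Subgroup.Commensurable A B := by
  have hc : Subgroup.Commensurable (A ⊓ B) A := by
    constructor
    · simpa [Subgroup.inf_relIndex_left] using h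
    · rw [Subgroup.relIndex_eq_one.2 inf_le_left]; exact one_ne_zero
  have h1 := hE.2.2 _ (hE.2.1 A hA _ hc) B hB inf_le_right
  refine ⟨?_, h⟩
  rwa [Subgroup.inf_relIndex_right] at h1

end GroupLemmas

section ActionLemmas

open SimpleGraph

variable {G V : Type*} [Group G] [MulAction G V] {T : SimpleGraph V}

theorem mem_edgeStab {g : G} {e : Sym2 V} : g ∈ edgeStab G e ↔ Sym2.map (g • ·) e = e := Iff.rfl

theorem edgeStab_fix (hinv : NoInversions T G) {x y : V} (hxy : T.Adj x y) {g : G}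
    (hg : g ∈ edgeStab G s(x, y)) : g • x = x ∧ g • y = y := by
  have h : s(g • x, g • y) = s(x, y) := hg
  rcases Sym2.eq_iff.1 h with h | h
  · exact h
  · exact absurd h (hinv g x y hxy)

/-- the graph endomorphism given by `g` -/
def actHom (hact : ActsOn T G) (g : G) : T →g T := ⟨(g • ·), fun {a b} h => hact g a b h⟩

theorem walk_smul (hact : ActsOn T G) (g : G) {a b : V} (p : T.Walk a b) :
    ∃ q : T.Walk (g • a) (g • b), q.edges = p.edges.map (Sym2.map (g • ·)) ∧
      q.length = p.length ∧ (p.IsPath → q.IsPath) :=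
  ⟨p.map (actHom hact g), Walk.edges_map _ _, Walk.length_map _ _,
    fun hp => Walk.IsPath.map (MulAction.injective g) hp⟩

theorem smul_mem_halfTree (hact : ActsOn T G) (g : G) {x y w : V} (h : w ∈ halfTree T x y) :
    g • w ∈ halfTree T (g • x) (g • y) := by
  obtain ⟨p, hp⟩ := mem_halfTree.1 h
  obtain ⟨q, hq, -⟩ := walk_smul hact g p
  refine mem_halfTree.2 ⟨q, ?_⟩
  intro hm
  rw [hq, List.mem_map] at hm
  obtain ⟨e, he, hee⟩ := hm
  have h2 : Sym2.map (g • ·) e = Sym2.map (g • ·) s(x, y) := hee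
  have := Sym2.map.injective (MulAction.injective g) h2
  rw [this] at he
  exact hp he

theorem smul_mem_halfTree_iff (hact : ActsOn T G) (g : G) {x y w : V} :
    g • w ∈ halfTree T (g • x) (g • y) ↔ w ∈ halfTree T x y := by
  refine ⟨fun h => ?_, smul_mem_halfTree hact g⟩
  have := smul_mem_halfTree hact g⁻¹ h
  simpa using this

theorem dist_smul_le (hT : T.IsTree) (hact : ActsOn T G) (g : G) (a b : V) :
    T.dist (g • a) (g • b) ≤ T.dist a b := by
  obtain ⟨p, hp⟩ := hT.connected.exists_walk_length_eq_dist a b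
  obtain ⟨q, -, hq, -⟩ := walk_smul hact g p
  rw [← hp, ← hq]
  exact dist_le q

theorem fix_path (hT : T.IsTree) (hact : ActsOn T G) {g : G} {a c : V} (ha : g • a = a)
    (hc : g • c = c) (p : T.Walk a c) (hp : p.IsPath) {e : Sym2 V} (he : e ∈ p.edges) :
    g ∈ edgeStab G e := by
  have hex := walk_smul hact g p
  rw [ha, hc] at hex
  obtain ⟨q, hq, -, hqp⟩ := hex
  have heq : q = p := (hT.existsUnique_path a c).unique (hqp hp) hp
  have h2 : (p.edges.map (Sym2.map (g • ·))) = p.edges := by rw [← hq, heq]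
  rw [mem_edgeStab]
  have h3 : p.edges.map (Sym2.map (g • ·)) = p.edges.map id := by rw [h2, List.map_id]
  exact List.map_inj_left.1 h3 e he

theorem exists_orbit_mem (hT : T.IsTree) (hact : ActsOn T G) (hmin : MinimalAction T G) (v₀ : V)
    {x y : V} (hxy : T.Adj x y) : ∃ g : G, g • v₀ ∈ halfTree T x y := by
  have := hmin {w | ∀ x y, T.Adj x y → w ∈ halfTree T x y → ∃ g : G, g • v₀ ∈ halfTree T x y}
    ⟨v₀, fun x y _ h => ⟨1, by simpa using h⟩⟩
    (by
      intro g a ha x y hxy h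
      have h2 := smul_mem_halfTree hact g⁻¹ h
      rw [inv_smul_smul] at h2
      obtain ⟨k, hk⟩ := ha _ _ (hact g⁻¹ _ _ hxy) h2
      refine ⟨g * k, ?_⟩
      have := smul_mem_halfTree hact g hk
      simpa [mul_smul] using this)
    (by
      intro a ha b hb w hw x y hxy h
      by_cases h1 : a ∈ halfTree T x y
      · exact ha x y hxy h1
      by_cases h2 : b ∈ halfTree T x y
      · exact hb x y hxy h2
      exfalso
      have h1' := (mem_or_mem hT x y a).resolve_left h1
      have h2' := (mem_or_mem hT x y b).resolve_left h2
      exact not_mem_both hT hxy h (halfTree_convex h1' h2' hw))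
  have hy : y ∈ (Set.univ : Set V) := trivial
  rw [← this] at hy
  exact hy x y hxy (self_mem_halfTree x y)

theorem exists_far (hT : T.IsTree)
    (hval3 : ∀ w : V, ∃ a b c : V, a ≠ b ∧ a ≠ c ∧ b ≠ c ∧ T.Adj w a ∧ T.Adj w b ∧ T.Adj w c)
    {x y : V} (hxy : T.Adj x y) (n : ℕ) : ∃ x' y', T.Adj x' y' ∧
      halfTree T x' y' ⊆ halfTree T x y ∧ ∀ t ∈ halfTree T x' y', n ≤ T.dist x t := by
  classical
  suffices h : ∃ x' y', T.Adj x' y' ∧ x ∉ halfTree T x' y' ∧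
      halfTree T x' y' ⊆ halfTree T x y ∧ ∀ t ∈ halfTree T x' y', n ≤ T.dist x t by
    obtain ⟨x', y', h1, -, h2⟩ := h
    exact ⟨x', y', h1, h2⟩
  induction n with
  | zero => exact ⟨x, y, hxy, not_self_mem hT hxy, le_refl _, fun _ _ => Nat.zero_le _⟩
  | succ n ih =>
    obtain ⟨x', y', h1, h0, h2, h3⟩ := ih
    obtain ⟨z, hz, hne⟩ : ∃ z, T.Adj y' z ∧ x' ≠ z := by
      obtain ⟨a, b, c, hab, -, -, ha, hb, -⟩ := hval3 y'
      by_cases h : x' = a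
      · exact ⟨b, hb, fun h' => hab (h.symm.trans h')⟩
      · exact ⟨a, ha, h⟩
    have hsub := halfTree_subset_halfTree hT h1 hz hne
    refine ⟨y', z, hz, fun h => h0 (hsub h), hsub.trans h2, ?_⟩
    intro t ht
    obtain ⟨p, hp⟩ := hT.connected.exists_walk_length_eq_dist x t
    have hx : x ∈ (halfTree T y' z)ᶜ := fun h => h0 (hsub h)
    obtain ⟨c, d, hcd, he, hc, hd, hcob⟩ := exists_cobdry_edge p hx (fun h => h ht)
    rw [cobdry_compl, cobdry_halfTree hT hz, Set.mem_singleton_iff] at hcob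
    have hy' : y' ∈ p.support := by
      rw [hcob] at he
      exact p.fst_mem_support_of_mem_edges he
    have hyt : y' ≠ t := by
      rintro rfl
      exact not_self_mem hT hz ht
    have hl := p.length_takeUntil_lt_length hy' hyt
    have := dist_le (p.takeUntil y' hy')
    have := h3 y' (self_mem_halfTree _ _)
    omega

theorem not_HFin_halfTree (hT : T.IsTree) (hact : ActsOn T G) (hinv : NoInversions T G)
    (hmin : MinimalAction T G)
    (hval3 : ∀ w : V, ∃ a b c : V, a ≠ b ∧ a ≠ c ∧ b ≠ c ∧ T.Adj w a ∧ T.Adj w b ∧ T.Adj w c)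
    (v₀ : V) {x y : V} (hxy : T.Adj x y) :
    ¬ HFin (edgeStab G s(x, y)) (XS G v₀ (halfTree T x y)) := by
  intro h
  obtain ⟨F, hF⟩ := mem_HFin_iff.1 h
  obtain ⟨x', y', h1, h2, h3⟩ := exists_far hT hval3 hxy (F.sup (fun f => T.dist x (f • v₀)) + 1)
  obtain ⟨g, hg⟩ := exists_orbit_mem hT hact hmin v₀ h1
  obtain ⟨f, hf, hgf⟩ := hF g (h2 hg)
  have h4 := h3 _ hg
  have h5 := dist_smul_le hT hact (g * f⁻¹) x (f • v₀)
  rw [(edgeStab_fix hinv hxy hgf).1, smul_smul, inv_mul_cancel_right] at h5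
  have h6 := Finset.le_sup (f := fun f => T.dist x (f • v₀)) hf
  omega

variable {E : Set (Subgroup G)}

theorem cyl_conv (hT : T.IsTree) (hact : ActsOn T G) (hinv : NoInversions T G)
    (hE : Admissible E) (hET : IsETree T G E) {Y : Set (Sym2 V)} (hY : IsCylinder T G Y)
    {a c : V} (ha : a ∈ cylVerts Y) (hc : c ∈ cylVerts Y) (p : T.Walk a c) (hp : p.IsPath)
    {e : Sym2 V} (he : e ∈ p.edges) : e ∈ Y := by
  obtain ⟨e1, he1, ha⟩ := ha
  obtain ⟨e2, he2, hc⟩ := hc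
  have heT : e ∈ T.edgeSet := p.edges_subset_edgeSet he
  rw [hY.2.2 e1 he1 e heT]
  have hcomm := (hY.2.2 e1 he1 e2 (hY.2.1 he2)).1 he2
  apply hE.comm (hET _ (hY.2.1 he1)) (hET _ heT)
  have hle : edgeStab G e1 ⊓ edgeStab G e2 ≤ edgeStab G e := by
    rintro g ⟨hg1, hg2⟩
    have fix : ∀ (f : Sym2 V) (z : V), f ∈ T.edgeSet → z ∈ f → g ∈ edgeStab G f → g • z = z := by
      intro f z hf hz hg
      obtain ⟨w, rfl⟩ := hz
      exact (edgeStab_fix hinv hf hg).1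
    exact fix_path hT hact (fix e1 a (hY.2.1 he1) ha hg1) (fix e2 c (hY.2.1 he2) hc hg2) p hp he
  have h2 : (edgeStab G e1 ⊓ edgeStab G e2).relIndex (edgeStab G e1) ≠ 0 := by
    rw [Subgroup.inf_relIndex_left]; exact hcomm.2
  intro h0
  exact h2 (Subgroup.relIndex_eq_zero_of_le_left hle h0)

end ActionLemmas

section Main

open SimpleGraph

/-- The standing hypotheses. -/
structure Ctx (G : Type*) {V : Type*} [Group G] [MulAction G V] (T : SimpleGraph V)
    (E : Set (Subgroup G)) (Y : Set (Sym2 V)) (e : Sym2 V) : Prop where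
  hT : T.IsTree
  hact : ActsOn T G
  hinv : NoInversions T G
  hE : Admissible E
  hET : IsETree T G E
  hmin : MinimalAction T G
  hval3 : ∀ w : V, ∃ a b c : V, a ≠ b ∧ a ≠ c ∧ b ≠ c ∧ T.Adj w a ∧ T.Adj w b ∧ T.Adj w c
  hY : IsCylinder T G Y
  he : e ∈ Y

variable {G V : Type*} [Group G] [MulAction G V] {T : SimpleGraph V}
    {E : Set (Subgroup G)} {Y : Set (Sym2 V)} {e : Sym2 V}

theorem HFin_of_fibers {A : Type*} {H : Subgroup G} {X : Set G} (φ : G → A)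
    (hfin : (φ '' X).Finite) (h : ∀ g₁ ∈ X, ∀ g₂ ∈ X, φ g₁ = φ g₂ → g₁ * g₂⁻¹ ∈ H) :
    HFin H X := by
  classical
  have hsub : X ⊆ ⋃ a ∈ φ '' X, {g | g ∈ X ∧ φ g = a} := by
    intro g hg
    simp only [Set.mem_iUnion]
    exact ⟨φ g, ⟨g, hg, rfl⟩, hg, rfl⟩
  refine HFin.mono (HFin_biUnion hfin ?_) hsub
  rintro _ ⟨g, hg, rfl⟩
  rw [mem_HFin_iff]
  exact ⟨{g}, fun x hx => ⟨g, by simp, h x hx.1 g hg hx.2⟩⟩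

namespace Ctx


theorem N_halfTree (c : Ctx G T E Y e) (v₀ : V) {x y : V} (hxy : T.Adj x y) (h : s(x, y) ∈ Y) :
    ¬ HFin (edgeStab G e) (XS G v₀ (halfTree T x y)) := by
  intro hf
  have hc := (c.hY.2.2 e c.he s(x, y) hxy).1 h
  exact not_HFin_halfTree c.hT c.hact c.hinv c.hmin c.hval3 v₀ hxy ((Comm_HFin hc).1 hf)

theorem N_boundary (c : Ctx G T E Y e) (v₀ : V) {S : Set V} (hS : IsSpecialForest T S Y) {w : V}
    (hw : w ∈ cylBoundary T Y) (hwS : w ∈ S) : ¬ HFin (edgeStab G e) (XS G v₀ S) := by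
  classical
  intro hf
  obtain ⟨hwY, e', he', hwe, hne⟩ := hw
  obtain ⟨z, rfl⟩ := hwe
  have hwz : T.Adj w z := he'
  have hsub : halfTree T w z ⊆ S := by
    apply halfTree_subset_of (special_step hS hwz hne hwS)
    intro a b hab ha hb haS
    refine special_step hS hab ?_ haS
    intro habY
    have haY : a ∈ cylVerts Y := ⟨_, habY, by simp⟩
    obtain ⟨p, hp, -⟩ := c.hT.existsUnique_path w a
    obtain ⟨q, r, -, he1, -, -, hcob⟩ := exists_cobdry_edge p
      (S := (halfTree T w z)ᶜ) (not_self_mem c.hT hwz) (fun h => h ha)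
    rw [cobdry_compl, cobdry_halfTree c.hT hwz, Set.mem_singleton_iff] at hcob
    rw [hcob] at he1
    exact hne (cyl_conv c.hT c.hact c.hinv c.hE c.hET c.hY hwY haY p hp he1)
  obtain ⟨g, hg⟩ := exists_orbit_mem c.hT c.hact c.hmin v₀ hwz
  have h1 : HFin (edgeStab G e) ((· * g) '' (edgeStab G s(w, z) : Set G)) := by
    refine hf.mono ?_
    rintro _ ⟨k, hk, rfl⟩
    apply hsub
    have hk' := edgeStab_fix c.hinv hwz hk
    have := smul_mem_halfTree c.hact k hg
    rw [hk'.1, hk'.2] at this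
    simpa [mul_smul] using this
  have h2 := relIndex_of_HFin h1
  have h3 := c.hE.comm (c.hET _ he') (c.hET _ (c.hY.2.1 c.he)) h2
  exact hne ((c.hY.2.2 e c.he _ he').2 h3.symm)

theorem sep (c : Ctx G T E Y e) {w w' : V} (hw : w ∈ cylVerts Y) (hw' : w' ∈ cylVerts Y) (hne : w ≠ w') :
    ∃ R, IsSpecialForest T R Y ∧ w ∈ R ∧ w' ∉ R := by
  obtain ⟨p, hp, -⟩ := c.hT.existsUnique_path w w'
  have hconv := fun f hf => cyl_conv c.hT c.hact c.hinv c.hE c.hET c.hY hw hw' p hp (e := f) hf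
  cases p with
  | nil => exact absurd rfl hne
  | @cons _ t _ h q =>
    have hY' : s(w, t) ∈ Y := hconv _ (by simp)
    refine ⟨halfTree T t w, special_halfTree c.hT h.symm (by rwa [Sym2.eq_swap]),
      self_mem_halfTree _ _, ?_⟩
    intro hmem
    refine not_mem_both c.hT h.symm hmem (mem_halfTree.2 ⟨q, ?_⟩)
    intro he
    exact ((Walk.cons_isPath_iff _ _).1 hp).2 (q.fst_mem_support_of_mem_edges he)

theorem inf_val (c : Ctx G T E Y e) {S : Set V} (hS : IsSpecialForest T S Y) {w : V} (hw : w ∈ S)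
    (hinf : ¬ FiniteValenceIn Y w) :
    ∃ t, T.Adj w t ∧ s(w, t) ∈ Y ∧ halfTree T w t ⊆ S := by
  have hD : (⋃ f ∈ cobdry T S, {z | z ∈ f}).Finite := by
    refine hS.1.biUnion ?_
    intro f _
    induction f with
    | _ a b =>
      refine (Set.toFinite {a, b}).subset ?_
      intro z hz
      simpa using hz
  have hbad : (⋃ z ∈ (⋃ f ∈ cobdry T S, {z | z ∈ f}),
      {f : Sym2 V | ∃ t, f = s(w, t) ∧ T.Adj w t ∧ z ∈ halfTree T w t}).Finite := by
    refine hD.biUnion ?_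
    intro z _
    apply Set.Subsingleton.finite
    rintro _ ⟨t, rfl, ht, hz⟩ _ ⟨t', rfl, ht', hz'⟩
    by_contra hne
    exact halfTree_disjoint c.hT ht ht' (fun h => hne (by rw [h])) hz hz'
  obtain ⟨f, ⟨hfY, hwf⟩, hf⟩ := Set.Infinite.exists_notMem_finite hinf hbad
  obtain ⟨t, rfl⟩ := hwf
  have ht : T.Adj w t := c.hY.2.1 hfY
  have key : ∀ g ∈ cobdry T S, ∀ z ∈ g, z ∉ halfTree T w t := by
    intro g hg z hz hzt
    apply hf
    simp only [Set.mem_iUnion, Set.mem_ofPred_eq]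
    exact ⟨z, ⟨g, hg, hz⟩, t, rfl, ht, hzt⟩
  refine ⟨t, ht, hfY, halfTree_subset_of ?_ ?_⟩
  · by_contra htS
    exact key _ (mem_cobdry_of ht hw htS) t (by simp) (self_mem_halfTree _ _)
  · intro a b hab ha hb haS
    by_contra hbS
    exact key _ (mem_cobdry_of hab haS hbS) a (by simp) ha

theorem interior_subset (c : Ctx G T E Y e) {S : Set V} (hS : IsSpecialForest T S Y) {x₀ : V} (hx₀ : x₀ ∉ S)
    (hb : ∀ w ∈ S, w ∉ cylBoundary T Y) {w : V} (hw : w ∈ S) : w ∈ cylVerts Y := by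
  obtain ⟨p⟩ := c.hT.connected.preconnected w x₀
  induction p with
  | nil => exact absurd hw hx₀
  | @cons a b _ h q ih =>
    by_cases hbS : b ∈ S
    · have := ih hx₀ hbS
      refine ⟨s(a, b), ?_, by simp⟩
      by_contra hne
      exact hb b hbS ⟨this, s(a, b), h, by simp, hne⟩
    · exact ⟨s(a, b), hS.2 (mem_cobdry_of h hw hbS), by simp⟩

theorem interior_edge (c : Ctx G T E Y e) {S : Set V} (hS : IsSpecialForest T S Y) {x₀ : V} (hx₀ : x₀ ∉ S)
    (hb : ∀ w ∈ S, w ∉ cylBoundary T Y) {w z : V} (hw : w ∈ S) (hwz : T.Adj w z) :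
    s(w, z) ∈ Y := by
  by_contra hne
  exact hb w hw ⟨c.interior_subset hS hx₀ hb hw, s(w, z), hwz, by simp, hne⟩

theorem dist_cross (c : Ctx G T E Y e) {x y a b : V} (hxy : T.Adj x y) (ha : a ∉ halfTree T x y)
    (hb : b ∈ halfTree T x y) : T.dist a x + 1 ≤ T.dist a b := by
  classical
  obtain ⟨p, hp⟩ := c.hT.connected.exists_walk_length_eq_dist a b
  obtain ⟨q, r, -, he, -, -, hcob⟩ := exists_cobdry_edge p (S := (halfTree T x y)ᶜ) ha
    (fun h => h hb)
  rw [cobdry_compl, cobdry_halfTree c.hT hxy, Set.mem_singleton_iff] at hcob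
  have hx : x ∈ p.support := by
    rw [hcob] at he
    exact p.fst_mem_support_of_mem_edges he
  have hne : x ≠ b := by
    rintro rfl
    exact not_self_mem c.hT hxy hb
  have hl := p.length_takeUntil_lt_length hx hne
  have := dist_le (p.takeUntil x hx)
  omega

theorem exists_parent (c : Ctx G T E Y e) (x₀ w : V) {n : ℕ} (h : T.dist x₀ w = n + 1) :
    ∃ p, T.Adj w p ∧ T.dist x₀ p = n := by
  obtain ⟨p, hp⟩ := c.hT.connected.exists_walk_length_eq_dist w x₀
  rw [dist_comm, h] at hp
  cases p with
  | nil => simp at hp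
  | @cons _ b _ hab q =>
    refine ⟨b, hab, ?_⟩
    rw [Walk.length_cons] at hp
    have h1 := dist_le q
    rw [dist_comm] at h1
    have h2 := c.hT.connected.dist_triangle (u := x₀) (v := b) (w := w)
    have h3 : T.dist b w ≤ 1 := by
      have := dist_le (Walk.cons hab.symm Walk.nil)
      simpa using this
    omega

theorem exists_halfTree (c : Ctx G T E Y e) (v₀ : V) {S : Set V} (hS : IsSpecialForest T S Y) {x₀ : V} (hx₀ : x₀ ∉ S)
    (hb : ∀ w ∈ S, w ∉ cylBoundary T Y) (hN : ¬ HFin (edgeStab G e) (XS G v₀ S)) :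
    ∃ x y, T.Adj x y ∧ s(x, y) ∈ Y ∧ halfTree T x y ⊆ S := by
  by_contra hcon
  push Not at hcon
  have hnb : ∀ w ∈ S, (T.neighborSet w).Finite := by
    intro w hw
    have hfv : FiniteValenceIn Y w := by
      by_contra hinf
      obtain ⟨t, h1, h2, h3⟩ := c.inf_val hS hw hinf
      exact hcon w t h1 h2 h3
    have : ((fun t => s(w, t)) '' T.neighborSet w).Finite := by
      refine hfv.subset ?_
      rintro _ ⟨t, ht, rfl⟩
      exact ⟨c.interior_edge hS hx₀ hb hw ht, by simp⟩
    refine this.of_finite_image ?_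
    intro a _ b _ hab
    exact Sym2.congr_right.1 hab
  -- each fibre is finite over `H`
  have hfib : ∀ w ∈ S, HFin (edgeStab G e) {g : G | g • v₀ = w} := by
    intro w hw
    rcases Set.eq_empty_or_nonempty {g : G | g • v₀ = w} with h0 | ⟨g₀, hg₀⟩
    · rw [h0]; exact HFin_empty _
    obtain ⟨t, -, -, -, -, -, ht, -⟩ := c.hval3 w
    have htY := c.interior_edge hS hx₀ hb hw ht
    rw [Comm_HFin ((c.hY.2.2 e c.he s(w, t) ht).1 htY)]
    refine HFin_of_fibers (fun g => g⁻¹ • t) ?_ ?_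
    · refine ((hnb w hw).image (g₀⁻¹ • ·)).subset ?_
      rintro _ ⟨g, hg, rfl⟩
      refine ⟨g₀ • g⁻¹ • t, ?_, by simp⟩
      have h1 := c.hact g₀ _ _ (c.hact g⁻¹ _ _ ht)
      have h2 : g⁻¹ • w = v₀ := by rw [← (hg : g • v₀ = w), inv_smul_smul]
      rw [h2, (hg₀ : g₀ • v₀ = w)] at h1
      exact h1
    · intro g₁ h₁ g₂ h₂ heq
      rw [mem_edgeStab]
      have hw2 : (g₁ * g₂⁻¹) • w = w := by
        rw [mul_smul, ← (h₂ : g₂ • v₀ = w), inv_smul_smul, (h₁ : g₁ • v₀ = w),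
          (h₂ : g₂ • v₀ = w)]
      have ht2 : (g₁ * g₂⁻¹) • t = t := by
        rw [mul_smul, ← (heq : g₁⁻¹ • t = g₂⁻¹ • t), smul_inv_smul]
      rw [Sym2.map_mk, hw2, ht2]
  apply hN
  have hD : (⋃ f ∈ cobdry T S, {z | z ∈ f}).Finite := by
    refine hS.1.biUnion ?_
    intro f _
    induction f with
    | _ a b =>
      refine (Set.toFinite {a, b}).subset ?_
      intro z hz
      simpa using hz
  have memD : ∀ a b, s(a, b) ∈ cobdry T S → a ∈ (⋃ f ∈ cobdry T S, {z | z ∈ f}) := by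
    intro a b hab
    simp only [Set.mem_iUnion]
    exact ⟨_, hab, by simp⟩
  have hlev : ∀ n, {w | w ∈ S ∧ T.dist x₀ w = n}.Finite := by
    intro n
    induction n with
    | zero =>
      refine (Set.finite_singleton x₀).subset ?_
      rintro w ⟨-, hw⟩
      exact ((c.hT.connected.dist_eq_zero_iff).1 hw).symm
    | succ n ih =>
      refine ((ih.biUnion (t := fun p => T.neighborSet p) ?_).union hD).subset ?_
      · intro p hp
        exact hnb p hp.1
      · rintro w ⟨hw, hd⟩
        obtain ⟨p, hp, hpd⟩ := c.exists_parent x₀ w hd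
        by_cases hpS : p ∈ S
        · left
          simp only [Set.mem_iUnion]
          exact ⟨p, ⟨hpS, hpd⟩, hp.symm⟩
        · right
          exact memD _ _ (mem_cobdry_of hp hw hpS)
  obtain ⟨R, hR⟩ : ∃ R, ∀ z ∈ (⋃ f ∈ cobdry T S, {z | z ∈ f}), T.dist x₀ z ≤ R := by
    obtain ⟨R, hR⟩ := (hD.image (T.dist x₀)).bddAbove
    exact ⟨R, fun z hz => hR ⟨z, hz, rfl⟩⟩
  have hbd : ∀ w ∈ S, T.dist x₀ w ≤ R := by
    intro w hw
    by_contra hlt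
    push Not at hlt
    obtain ⟨n, hn⟩ : ∃ n, T.dist x₀ w = n + 1 := ⟨T.dist x₀ w - 1, by omega⟩
    obtain ⟨p, hp, hpd⟩ := c.exists_parent x₀ w hn
    have hx : x₀ ∉ halfTree T p w := by
      intro hx
      have := c.dist_cross (x := w) (y := p) (a := x₀) (b := p) hp
        (fun h => not_mem_both c.hT hp h hx) (self_mem_halfTree _ _)
      omega
    refine hcon p w hp.symm ?_ ?_
    · rw [Sym2.eq_swap]; exact c.interior_edge hS hx₀ hb hw hp
    · refine halfTree_subset_of hw ?_
      intro a b hab ha hb' haS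
      by_contra hbS
      have h1 := hR a (memD _ _ (mem_cobdry_of hab haS hbS))
      have h2 := c.dist_cross hp.symm hx ha
      omega
  have hSfin : S.Finite := by
    refine ((Set.finite_Iic R).biUnion (fun n _ => hlev n)).subset ?_
    intro w hw
    simp only [Set.mem_iUnion]
    exact ⟨T.dist x₀ w, hbd w hw, hw, rfl⟩
  refine (HFin_biUnion hSfin hfib).mono ?_
  intro g hg
  simp only [Set.mem_iUnion]
  exact ⟨g • v₀, hg, rfl⟩

theorem peri_special (c : Ctx G T E Y e) {w : V} (hfv : FiniteValenceIn Y w) :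
    IsSpecialForest T (periForest T Y w) Y := by
  classical
  have key : cobdry T (periForest T Y w) ⊆ {f | f ∈ Y ∧ w ∈ f} := by
    rintro f ⟨hf, a, b, rfl, ⟨p, hp, hpe⟩, hbn⟩
    have hab : T.Adj a b := hf
    by_contra hcon
    apply hbn
    refine ⟨(p.append (Walk.cons hab Walk.nil)).bypass, Walk.bypass_isPath _, ?_⟩
    intro f hfY hwf hmem
    have h2 := Walk.edges_bypass_subset_edges _ hmem
    simp only [Walk.edges_append, Walk.edges_cons, Walk.edges_nil, List.mem_append,
      List.mem_singleton] at h2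
    rcases h2 with h2 | rfl
    · exact hpe f hfY hwf h2
    · exact hcon ⟨hfY, hwf⟩
  exact ⟨hfv.subset key, fun f hf => (key hf).1⟩

theorem self_mem_peri (c : Ctx G T E Y e) (w : V) : w ∈ periForest T Y w := ⟨Walk.nil, Walk.IsPath.nil, by simp⟩

theorem peri_subset (c : Ctx G T E Y e) {S : Set V} (hS : IsSpecialForest T S Y) {w : V} (hwY : w ∈ cylVerts Y)
    (hw : w ∈ S) : periForest T Y w ⊆ S := by
  classical
  rintro t ⟨p, hp, hpe⟩
  by_contra htS
  obtain ⟨a, b, hab, he, -, -, hcob⟩ := exists_cobdry_edge p hw htS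
  have habY := hS.2 hcob
  have key : ∀ z ∈ p.support, z ∈ cylVerts Y → w = z := by
    intro z hz hzY
    by_contra hne
    have hq := hp.takeUntil hz
    have hsub := p.edges_takeUntil_subset_edges hz
    have hconv := fun f hf => cyl_conv c.hT c.hact c.hinv c.hE c.hET c.hY hwY hzY
      (p.takeUntil z hz) hq (e := f) hf
    generalize p.takeUntil z hz = q at hq hsub hconv
    cases q with
    | nil => exact hne rfl
    | @cons _ t' _ h q =>
      exact hpe s(w, t') (hconv _ (by simp)) (by simp) (hsub (by simp))
  have h1 := key a (p.fst_mem_support_of_mem_edges he) ⟨_, habY, by simp⟩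
  have h2 := key b (p.snd_mem_support_of_mem_edges he) ⟨_, habY, by simp⟩
  exact hab.ne (h1.symm.trans h2)

/-- Main dichotomy: a non-trivial special forest is splittable or peripheral. -/
theorem split_or_peri (c : Ctx G T E Y e) (v₀ : V) {S : Set V} (hS : IsSpecialForest T S Y)
    (hN : ¬ HFin (edgeStab G e) (XS G v₀ S)) {u : V} (hu : u ∈ cylBoundary T Y) :
    (∃ A, IsSpecialForest T A Y ∧ ¬ HFin (edgeStab G e) (XS G v₀ (S ∩ A)) ∧
      ¬ HFin (edgeStab G e) (XS G v₀ (S \ A))) ∨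
    ∃ w ∈ cylBoundary T Y, FiniteValenceIn Y w ∧
      HFin (edgeStab G e) (XS G v₀ S ∆ XS G v₀ (periForest T Y w)) := by
  by_cases hb : ∃ w ∈ S, w ∈ cylBoundary T Y
  · obtain ⟨w, hw, hwb⟩ := hb
    by_cases hfv : FiniteValenceIn Y w
    · have hsp := c.peri_special hfv
      by_cases h2 : HFin (edgeStab G e) (XS G v₀ (S \ periForest T Y w))
      · right
        refine ⟨w, hwb, hfv, h2.mono ?_⟩
        have hsub := c.peri_subset hS hwb.1 hw
        rintro g (⟨h1, h2⟩ | ⟨h1, h2⟩)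
        · exact ⟨h1, h2⟩
        · exact absurd (hsub h1) h2
      · left
        exact ⟨_, hsp, c.N_boundary v₀ (special_inter hS hsp) hwb ⟨hw, c.self_mem_peri w⟩, h2⟩
    · left
      obtain ⟨t, ht, htY, hsub⟩ := c.inf_val hS hw hfv
      have hsp := special_halfTree c.hT ht htY
      refine ⟨halfTree T w t, hsp, ?_,
        c.N_boundary v₀ (special_diff hS hsp) hwb ⟨hw, not_self_mem c.hT ht⟩⟩
      rw [Set.inter_eq_right.2 hsub]
      exact c.N_halfTree v₀ ht htY
  · left
    push Not at hb
    have hu' : u ∉ S := fun h => hb u h hu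
    obtain ⟨x, y, hxy, hxyY, hsub⟩ := c.exists_halfTree v₀ hS hu' hb hN
    have hyS : y ∈ S := hsub (self_mem_halfTree x y)
    obtain ⟨a, b, hax, hbx, hab, ha, hb'⟩ : ∃ a b, x ≠ a ∧ x ≠ b ∧ a ≠ b ∧ T.Adj y a ∧ T.Adj y b := by
      obtain ⟨a, b, d, h1, h2, h3, h4, h5, h6⟩ := c.hval3 y
      by_cases hxa : x = a
      · exact ⟨b, d, hxa ▸ h1, hxa ▸ h2, h3, h5, h6⟩
      by_cases hxb : x = b
      · exact ⟨a, d, hxa, hxb ▸ h3, h2, h4, h6⟩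
      · exact ⟨a, b, hxa, hxb, h1, h4, h5⟩
    have haY := c.interior_edge hS hu' hb hyS ha
    have hbY := c.interior_edge hS hu' hb hyS hb'
    have hsa := (halfTree_subset_halfTree c.hT hxy ha hax).trans hsub
    have hsb := (halfTree_subset_halfTree c.hT hxy hb' hbx).trans hsub
    refine ⟨halfTree T y a, special_halfTree c.hT ha haY, ?_, ?_⟩
    · rw [Set.inter_eq_right.2 hsa]
      exact c.N_halfTree v₀ ha haY
    · intro h
      refine c.N_halfTree v₀ hb' hbY (h.mono ?_)
      intro g hg
      exact ⟨hsb hg, fun h' => halfTree_disjoint c.hT ha hb' hab h' hg⟩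

theorem exists_stab (c : Ctx G T E Y e) {S : Set V} (hS : IsSpecialForest T S Y) :
    ∃ H' : Subgroup G, H' ≤ edgeStab G e ∧ HFin H' (edgeStab G e : Set G) ∧
      ∀ h ∈ H', ∀ w : V, h • w ∈ S ↔ w ∈ S := by
  suffices h : ∃ H' : Subgroup G, H' ≤ edgeStab G e ∧ H'.relIndex (edgeStab G e) ≠ 0 ∧
      ∀ h ∈ H', ∀ w : V, h • w ∈ S ↔ w ∈ S by
    obtain ⟨H', h1, h2, h3⟩ := h
    exact ⟨H', h1, HFin_of_relIndex h2, h3⟩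
  refine special_induction (P := fun S => ∃ H' : Subgroup G, H' ≤ edgeStab G e ∧
    H'.relIndex (edgeStab G e) ≠ 0 ∧ ∀ h ∈ H', ∀ w : V, h • w ∈ S ↔ w ∈ S) c.hT ?_ ?_ ?_ S hS
  · exact ⟨_, le_refl _, by simp, by simp⟩
  · exact ⟨_, le_refl _, by simp, by simp⟩
  · rintro S x y ⟨H', h1, h2, h3⟩ hxy hxyY
    have hc := (c.hY.2.2 e c.he s(x, y) hxy).1 hxyY
    refine ⟨H' ⊓ edgeStab G s(x, y), inf_le_left.trans h1, Subgroup.relIndex_inf_ne_zero h2 hc.2, ?_⟩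
    rintro h ⟨hh1, hh2⟩ w
    have hfix := edgeStab_fix c.hinv hxy hh2
    have h4 := smul_mem_halfTree_iff c.hact h (x := x) (y := y) (w := w)
    rw [hfix.1, hfix.2] at h4
    simp only [Set.mem_symmDiff, h4, h3 h hh1 w]

theorem right_ai (c : Ctx G T E Y e) (v₀ : V) {S : Set V} (hS : IsSpecialForest T S Y) (s : G) :
    HFin (edgeStab G e) (((· * s) '' XS G v₀ S) ∆ XS G v₀ S) := by
  classical
  obtain ⟨p⟩ := c.hT.connected.preconnected v₀ (s⁻¹ • v₀)
  have hfin2 : HFin (edgeStab G e) (⋃ f ∈ {f | f ∈ p.edges}, ⋃ f' ∈ cobdry T S,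
      {g : G | Sym2.map (g • ·) f = f'}) := by
    refine HFin_biUnion (List.finite_toSet p.edges) fun f _ => HFin_biUnion hS.1 fun f' hf' => ?_
    have hf'Y := hS.2 hf'
    rw [Comm_HFin ((c.hY.2.2 e c.he f' (c.hY.2.1 hf'Y)).1 hf'Y)]
    refine HFin_of_fibers (fun _ => ()) (Set.toFinite _) ?_
    intro g₁ h₁ g₂ h₂ _
    have h₁' : Sym2.map (g₁ • ·) f = f' := h₁
    have h₂' : Sym2.map (g₂ • ·) f = f' := h₂
    rw [mem_edgeStab]
    conv_lhs => rw [← h₂']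
    rw [Sym2.map_map]
    have : (((g₁ * g₂⁻¹) • ·) ∘ (g₂ • ·) : V → V) = (g₁ • ·) := by
      funext v; simp [mul_smul]
    rw [this, h₁']
  refine hfin2.mono ?_
  intro g hg
  have hex : ¬ (g • v₀ ∈ S ↔ g • s⁻¹ • v₀ ∈ S) := by
    have hm : g ∈ (· * s) '' XS G v₀ S ↔ g • s⁻¹ • v₀ ∈ S := by
      constructor
      · rintro ⟨k, hk, rfl⟩
        have hk' : k • v₀ ∈ S := hk
        simpa [mul_smul] using hk'
      · intro h
        refine ⟨g * s⁻¹, ?_, by simp⟩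
        show (g * s⁻¹) • v₀ ∈ S
        rwa [mul_smul]
    have hm' : g ∈ XS G v₀ S ↔ g • v₀ ∈ S := Iff.rfl
    rw [Set.mem_symmDiff, hm, hm'] at hg
    tauto
  obtain ⟨q, hq, -⟩ := walk_smul c.hact g p
  have : ∃ f' ∈ cobdry T S, f' ∈ q.edges := by
    by_cases h1 : g • v₀ ∈ S
    · obtain ⟨a, b, -, he, -, -, hcob⟩ := exists_cobdry_edge q h1 (by tauto)
      exact ⟨_, hcob, he⟩
    · obtain ⟨a, b, -, he, -, -, hcob⟩ := exists_cobdry_edge (S := Sᶜ) q h1 (by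
        intro h; exact h (by tauto))
      rw [cobdry_compl] at hcob
      exact ⟨_, hcob, he⟩
  obtain ⟨f', hf', hfq⟩ := this
  rw [hq, List.mem_map] at hfq
  obtain ⟨f, hf, hff⟩ := hfq
  simp only [Set.mem_iUnion]
  exact ⟨f, hf, f', hf', hff⟩

theorem nontrivAI (c : Ctx G T E Y e) (v₀ : V) {S : Set V} (hS : IsSpecialForest T S Y)
    (hN : ¬ HFin (edgeStab G e) (XS G v₀ S)) (hN' : ¬ HFin (edgeStab G e) (XS G v₀ Sᶜ)) :
    ∃ H' : Subgroup G, (∀ X, HFin H' X ↔ HFin (edgeStab G e) X) ∧ NontrivAI H' (XS G v₀ S) := by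
  classical
  obtain ⟨H', hle, hfin, hst⟩ := c.exists_stab hS
  have hiff : ∀ X, HFin H' X ↔ HFin (edgeStab G e) X := by
    intro X
    refine ⟨fun h => h.trans ?_, fun h => h.trans hfin⟩
    rw [mem_HFin_iff]
    exact ⟨{1}, fun x hx => ⟨1, by simp, by simpa using hle hx⟩⟩
  refine ⟨H', hiff, ⟨?_, ?_⟩, fun h => hN ((hiff _).1 h), fun h => hN' ((hiff _).1 h)⟩
  · intro h hh
    ext g
    constructor
    · rintro ⟨k, hk, rfl⟩
      show (h * k) • v₀ ∈ S
      rw [mul_smul, hst h hh]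
      exact hk
    · intro hg
      refine ⟨h⁻¹ * g, ?_, by simp⟩
      show (h⁻¹ * g) • v₀ ∈ S
      rw [mul_smul, hst _ (H'.inv_mem hh)]
      exact hg
  · intro s
    rw [hiff]
    exact c.right_ai v₀ hS s

theorem mem_BCT (c : Ctx G T E Y e) (v₀ : V) {S : Set V} (hS : IsSpecialForest T S Y) :
    XS G v₀ S ∈ BCT T v₀ Y (edgeStab G e) := by
  rintro F ⟨hF1, hF2, hF3, hF4⟩
  have hsd : ∀ X ∈ F, ∀ X' ∈ F, X ∆ X' ∈ F := by
    intro X hX X' hX'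
    have h1 := hF2 _ (hF3 _ hX _ (hF2 _ hX'))
    have h2 := hF2 _ (hF3 _ hX' _ (hF2 _ hX))
    have h3 := hF2 _ (hF3 _ h1 _ h2)
    convert h3 using 1
    ext g
    simp only [Set.mem_symmDiff, Set.mem_compl_iff, Set.mem_inter_iff]
    tauto
  obtain ⟨Z, hZ⟩ : ∃ Z, Z ∈ F := by
    have he := c.he
    have heT := c.hY.2.1 he
    induction e with
    | _ a b => exact ⟨_, hF1 a b heT he⟩
  have hempty : (∅ : Set G) ∈ F := by
    have := hsd Z hZ Z hZ
    rwa [symmDiff_self] at this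
  refine special_induction (P := fun S => XS G v₀ S ∈ F) c.hT ?_ ?_ ?_ S hS
  · exact hempty
  · have := hF2 _ hempty
    convert this using 1
    ext g; simp [XS]
  · intro S x y hP hxy hxyY
    exact hsd _ hP _ (hF1 x y hxy hxyY)

theorem of_BCT (c : Ctx G T E Y e) (v₀ : V) {X : Set G} (hX : X ∈ BCT T v₀ Y (edgeStab G e)) :
    ∃ S, IsSpecialForest T S Y ∧ HFin (edgeStab G e) (X ∆ XS G v₀ S) := by
  refine hX {X | ∃ S, IsSpecialForest T S Y ∧ HFin (edgeStab G e) (X ∆ XS G v₀ S)}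
    ⟨?_, ?_, ?_, ?_⟩
  · intro x y hxy hxyY
    refine ⟨_, special_halfTree c.hT hxy hxyY, ?_⟩
    unfold Ze
    rw [symmDiff_self]
    exact HFin_empty _
  · rintro X ⟨S, hS, hf⟩
    refine ⟨Sᶜ, special_compl hS, hf.mono ?_⟩
    intro g
    simp only [Set.mem_symmDiff, XS, Set.mem_ofPred_eq, Set.mem_compl_iff]
    tauto
  · rintro X ⟨S, hS, hf⟩ X' ⟨S', hS', hf'⟩
    refine ⟨S ∩ S', special_inter hS hS', (hf.union hf').mono ?_⟩
    intro g
    simp only [Set.mem_symmDiff, XS, Set.mem_ofPred_eq, Set.mem_inter_iff, Set.mem_union]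
    tauto
  · rintro X ⟨S, hS, hf⟩ X' hf'
    refine ⟨S, hS, (hf.union hf').mono ?_⟩
    intro g
    simp only [Set.mem_symmDiff, XS, Set.mem_ofPred_eq, Set.mem_union]
    tauto



theorem nn_of (c : Ctx G T E Y e) {v₀ : V} {S S' Z : Set V} (hN : ¬ HFin (edgeStab G e) (XS G v₀ S))
    (hZ : HFin (edgeStab G e) (XS G v₀ Z)) (hsub : S ⊆ S' ∪ Z) :
    ¬ HFin (edgeStab G e) (XS G v₀ S') := by
  intro h
  exact hN ((h.union hZ).mono fun g hg => hsub hg)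

theorem nn_mono (c : Ctx G T E Y e) {v₀ : V} {S S' : Set V} (hN : ¬ HFin (edgeStab G e) (XS G v₀ S))
    (hsub : S ⊆ S') : ¬ HFin (edgeStab G e) (XS G v₀ S') := by
  intro h
  exact hN (h.mono fun g hg => hsub hg)

theorem nontrivB (c : Ctx G T E Y e) (v₀ : V) {S : Set V} (hS : IsSpecialForest T S Y)
    (hN : ¬ HFin (edgeStab G e) (XS G v₀ S)) (hN' : ¬ HFin (edgeStab G e) (XS G v₀ Sᶜ)) :
    XS G v₀ S ∈ NontrivB T G v₀ := by
  obtain ⟨H', -, h⟩ := c.nontrivAI v₀ hS hN hN'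
  exact ⟨⟨Y, c.hY, e, c.he, c.mem_BCT v₀ hS⟩, H', h⟩

theorem cc_same (c : Ctx G T E Y e) (v₀ : V) {S S' : Set V} (hS : IsSpecialForest T S Y)
    (hS' : IsSpecialForest T S' Y)
    (hN : ¬ HFin (edgeStab G e) (XS G v₀ S)) (hN' : ¬ HFin (edgeStab G e) (XS G v₀ Sᶜ))
    (h : HFin (edgeStab G e) (XS G v₀ S ∆ XS G v₀ S')) :
    ccRel T G v₀ (XS G v₀ S) (XS G v₀ S') := by
  obtain ⟨H', hiff, hH⟩ := c.nontrivAI v₀ hS hN hN'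
  refine Relation.EqvGen.rel _ _ ⟨c.nontrivB v₀ hS hN hN', c.nontrivB v₀ hS' ?_ ?_,
    Or.inr ⟨H', hH, Or.inl ((hiff _).2 h)⟩⟩
  · intro h2
    refine hN ((h.union h2).mono fun g hg => ?_)
    by_cases hg' : g ∈ XS G v₀ S'
    · exact Or.inr hg'
    · exact Or.inl (Or.inl ⟨hg, hg'⟩)
  · intro h2
    refine hN' ((h.union h2).mono fun g hg => ?_)
    by_cases hg' : g ∈ XS G v₀ S'
    · exact Or.inl (Or.inr ⟨hg', hg⟩)
    · exact Or.inr hg'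

theorem cc_compl (c : Ctx G T E Y e) (v₀ : V) {S : Set V} (hS : IsSpecialForest T S Y)
    (hN : ¬ HFin (edgeStab G e) (XS G v₀ S)) (hN' : ¬ HFin (edgeStab G e) (XS G v₀ Sᶜ)) :
    ccRel T G v₀ (XS G v₀ S) (XS G v₀ Sᶜ) := by
  obtain ⟨H', hiff, hH⟩ := c.nontrivAI v₀ hS hN hN'
  refine Relation.EqvGen.rel _ _ ⟨c.nontrivB v₀ hS hN hN',
    c.nontrivB v₀ (special_compl hS) hN' (by rwa [compl_compl]),
    Or.inr ⟨H', hH, Or.inr ?_⟩⟩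
  have : (XS G v₀ Sᶜ)ᶜ = XS G v₀ S := by ext g; simp [XS]
  rw [this, symmDiff_self]
  exact HFin_empty _

theorem cc_cross (c : Ctx G T E Y e) (v₀ : V) {S S' : Set V} (hS : IsSpecialForest T S Y)
    (hS' : IsSpecialForest T S' Y)
    (h1 : ¬ HFin (edgeStab G e) (XS G v₀ (S ∩ S')))
    (h2 : ¬ HFin (edgeStab G e) (XS G v₀ (S ∩ S'ᶜ)))
    (h3 : ¬ HFin (edgeStab G e) (XS G v₀ (Sᶜ ∩ S')))
    (h4 : ¬ HFin (edgeStab G e) (XS G v₀ (Sᶜ ∩ S'ᶜ))) :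
    ccRel T G v₀ (XS G v₀ S) (XS G v₀ S') := by
  have n1 := c.nn_mono h1 Set.inter_subset_left
  have n2 := c.nn_mono h3 Set.inter_subset_left
  have n3 := c.nn_mono h1 Set.inter_subset_right
  have n4 := c.nn_mono h2 Set.inter_subset_right
  obtain ⟨H', hiff, hH⟩ := c.nontrivAI v₀ hS n1 n2
  obtain ⟨K', -, hK⟩ := c.nontrivAI v₀ hS' n3 n4
  exact Relation.EqvGen.rel _ _ ⟨c.nontrivB v₀ hS n1 n2, c.nontrivB v₀ hS' n3 n4,
    Or.inl ⟨H', K', hH, hK, fun h => h1 ((hiff _).1 h), fun h => h2 ((hiff _).1 h),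
      fun h => h3 ((hiff _).1 h), fun h => h4 ((hiff _).1 h)⟩⟩

theorem cc_split_aux (c : Ctx G T E Y e) (v₀ : V) {S S' : Set V} (hS : IsSpecialForest T S Y)
    (hS' : IsSpecialForest T S' Y)
    (sp : ∃ A, IsSpecialForest T A Y ∧ ¬ HFin (edgeStab G e) (XS G v₀ (S ∩ A)) ∧
      ¬ HFin (edgeStab G e) (XS G v₀ (S \ A)))
    (sp' : ∃ A, IsSpecialForest T A Y ∧ ¬ HFin (edgeStab G e) (XS G v₀ (S' ∩ A)) ∧
      ¬ HFin (edgeStab G e) (XS G v₀ (S' \ A)))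
    (h : HFin (edgeStab G e) (XS G v₀ (S ∩ S'))) :
    ccRel T G v₀ (XS G v₀ S) (XS G v₀ S') := by
  obtain ⟨A, hA, hA1, hA2⟩ := sp
  obtain ⟨B, hB, hB1, hB2⟩ := sp'
  have hR : IsSpecialForest T (((S ∩ A) \ S') ∪ ((S' ∩ B) \ S)) Y :=
    special_union (special_diff (special_inter hS hA) hS')
      (special_diff (special_inter hS' hB) hS)
  have r1 : ccRel T G v₀ (XS G v₀ S) (XS G v₀ (((S ∩ A) \ S') ∪ ((S' ∩ B) \ S))) := by
    refine c.cc_cross v₀ hS hR (c.nn_of hA1 h ?_) (c.nn_of hA2 h ?_) (c.nn_of hB1 h ?_)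
      (c.nn_of hB2 h ?_) <;>
    · intro x
      simp only [Set.mem_inter_iff, Set.mem_sdiff, Set.mem_union, Set.mem_compl_iff]
      tauto
  have r2 : ccRel T G v₀ (XS G v₀ S') (XS G v₀ (((S ∩ A) \ S') ∪ ((S' ∩ B) \ S))) := by
    refine c.cc_cross v₀ hS' hR (c.nn_of hB1 h ?_) (c.nn_of hB2 h ?_) (c.nn_of hA1 h ?_)
      (c.nn_of hA2 h ?_) <;>
    · intro x
      simp only [Set.mem_inter_iff, Set.mem_sdiff, Set.mem_union, Set.mem_compl_iff]
      tauto
  exact r1.trans _ _ _ (r2.symm _ _)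

theorem cc_split (c : Ctx G T E Y e) (v₀ : V) {S S' : Set V} (hS : IsSpecialForest T S Y)
    (hS' : IsSpecialForest T S' Y)
    (sp : ∃ A, IsSpecialForest T A Y ∧ ¬ HFin (edgeStab G e) (XS G v₀ (S ∩ A)) ∧
      ¬ HFin (edgeStab G e) (XS G v₀ (S \ A)))
    (spc : ∃ A, IsSpecialForest T A Y ∧ ¬ HFin (edgeStab G e) (XS G v₀ (Sᶜ ∩ A)) ∧
      ¬ HFin (edgeStab G e) (XS G v₀ (Sᶜ \ A)))
    (sp' : ∃ A, IsSpecialForest T A Y ∧ ¬ HFin (edgeStab G e) (XS G v₀ (S' ∩ A)) ∧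
      ¬ HFin (edgeStab G e) (XS G v₀ (S' \ A)))
    (spc' : ∃ A, IsSpecialForest T A Y ∧ ¬ HFin (edgeStab G e) (XS G v₀ (S'ᶜ ∩ A)) ∧
      ¬ HFin (edgeStab G e) (XS G v₀ (S'ᶜ \ A))) :
    ccRel T G v₀ (XS G v₀ S) (XS G v₀ S') := by
  have hN {Z : Set V} (h : ∃ A, IsSpecialForest T A Y ∧
      ¬ HFin (edgeStab G e) (XS G v₀ (Z ∩ A)) ∧ ¬ HFin (edgeStab G e) (XS G v₀ (Z \ A))) :
      ¬ HFin (edgeStab G e) (XS G v₀ Z) := by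
    obtain ⟨A, -, h, -⟩ := h
    exact c.nn_mono h Set.inter_subset_left
  have hc := c.cc_compl v₀ hS (hN sp) (hN spc)
  have hc' := c.cc_compl v₀ hS' (hN sp') (hN spc')
  by_cases h1 : HFin (edgeStab G e) (XS G v₀ (S ∩ S'))
  · exact c.cc_split_aux v₀ hS hS' sp sp' h1
  by_cases h2 : HFin (edgeStab G e) (XS G v₀ (S ∩ S'ᶜ))
  · exact (c.cc_split_aux v₀ hS (special_compl hS') sp spc' h2).trans _ _ _ (hc'.symm _ _)
  by_cases h3 : HFin (edgeStab G e) (XS G v₀ (Sᶜ ∩ S'))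
  · exact hc.trans _ _ _ (c.cc_split_aux v₀ (special_compl hS) hS' spc sp' h3)
  by_cases h4 : HFin (edgeStab G e) (XS G v₀ (Sᶜ ∩ S'ᶜ))
  · exact hc.trans _ _ _ ((c.cc_split_aux v₀ (special_compl hS) (special_compl hS') spc spc'
      h4).trans _ _ _ (hc'.symm _ _))
  exact c.cc_cross v₀ hS hS' h1 h2 h3 h4

/-- A non-trivial `H`-almost invariant set which is equivalent to a special forest based on `Y`
has `G_e.relIndex H ≠ 0`. -/
theorem relIndex_of_ai (c : Ctx G T E Y e) (v₀ : V) {S : Set V} (hS : IsSpecialForest T S Y) {X : Set G}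
    {H : Subgroup G} (hX : NontrivAI H X)
    (h : HFin (edgeStab G e) (X ∆ XS G v₀ S)) : (edgeStab G e).relIndex H ≠ 0 := by
  obtain ⟨⟨hinv, -⟩, hN, hN'⟩ := hX
  have hne : X.Nonempty := by
    rw [Set.nonempty_iff_ne_empty]
    rintro rfl
    exact hN (HFin_empty _)
  have hne' : (Xᶜ).Nonempty := by
    rw [Set.nonempty_iff_ne_empty]
    intro h0
    rw [h0] at hN'
    exact hN' (HFin_empty _)
  obtain ⟨x, hx⟩ := hne
  obtain ⟨y, hy⟩ := hne'
  have hl : ∀ k ∈ H, ∀ z ∈ X, k * z ∈ X := by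
    intro k hk z hz
    rw [← hinv k hk]
    exact ⟨z, hz, rfl⟩
  have hl' : ∀ k ∈ H, ∀ z, z ∉ X → k * z ∉ X := by
    intro k hk z hz h'
    have := hl _ (H.inv_mem hk) _ h'
    simp only [inv_mul_cancel_left] at this
    exact hz this
  refine relIndex_of_HFin (g := y) ?_
  have h1 := c.right_ai v₀ hS (x⁻¹ * y)
  have h2 := h.mul_right (x⁻¹ * y)
  refine ((h.union h1).union h2).mono ?_
  rintro _ ⟨k, hk, rfl⟩
  have hkx : k * x ∈ X := hl k hk x hx
  have hky : k * y ∉ X := hl' k hk y hy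
  by_cases ha : k * y ∈ XS G v₀ S
  · exact Or.inl (Or.inl (Or.inr ⟨ha, hky⟩))
  by_cases hb : k * x ∈ XS G v₀ S
  · refine Or.inl (Or.inr (Or.inl ⟨⟨k * x, hb, ?_⟩, ha⟩))
    simp [mul_assoc]
  · refine Or.inr ⟨k * x, Or.inl ⟨hkx, hb⟩, ?_⟩
    simp [mul_assoc]

end Ctx

end Main

theorem ccRel_mem {G V : Type*} [Group G] [MulAction G V] {T : SimpleGraph V} {v₀ : V}
    {X X' : Set G} (h : ccRel T G v₀ X X') : X ∈ NontrivB T G v₀ ↔ X' ∈ NontrivB T G v₀ := by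
  induction h with
  | rel _ _ h => exact ⟨fun _ => h.2.1, fun _ => h.1⟩
  | refl => exact Iff.rfl
  | symm _ _ _ ih => exact ih.symm
  | trans _ _ _ _ _ ih1 ih2 => exact ih1.trans ih2


/-- If `|∂Y| ≥ 4` then for all `u ≠ v` in `∂Y` the non-peripheral
cross-connected component based on `Y` is represented by a special forest `S` with
`u ∈ S` and `v ∈ S*`. -/
theorem stmt_12 {G V : Type*} [Group G] [MulAction G V]
    (hGfg : Group.FG G)
    (T : SimpleGraph V) (hT : T.IsTree) (hact : ActsOn T G) (hinv : NoInversions T G)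
    (E : Set (Subgroup G)) (hE : Admissible E) (hET : IsETree T G E)
    (hmin : MinimalAction T G) (v₀ : V)
    (hval3 : ∀ w : V, ∃ a b c : V, a ≠ b ∧ a ≠ c ∧ b ≠ c ∧ T.Adj w a ∧ T.Adj w b ∧ T.Adj w c)
    (Y : Set (Sym2 V)) (hY : IsCylinder T G Y)
    (hbig : ∃ s : Finset V, s.card = 4 ∧ ↑s ⊆ cylBoundary T Y)
    (u v : V) (hu : u ∈ cylBoundary T Y) (hv : v ∈ cylBoundary T Y) (huv : u ≠ v)
    (C : Set (Set G)) (hC : IsCCC T G v₀ C) (hCY : CCCBasedOn G Y C)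
    (hnp : ¬ PeripheralCCC T G v₀ C) :
    ∃ S : Set V, IsSpecialForest T S Y ∧ XS G v₀ S ∈ C ∧ u ∈ S ∧ v ∈ (Sᶜ : Set V) := by
  classical
  obtain ⟨X, hX, rfl⟩ := hC
  obtain ⟨X1, hX1, H, ⟨e, he, hHe⟩, hAI⟩ := hCY
  have hX1' : ccRel T G v₀ X X1 := hX1
  have hX1B := (ccRel_mem hX1').1 hX
  obtain ⟨⟨Y', hY', e', he', hB⟩, -⟩ := id hX1B
  have c' : Ctx G T E Y' e' := ⟨hT, hact, hinv, hE, hET, hmin, hval3, hY', he'⟩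
  obtain ⟨S, hS, hXS⟩ := c'.of_BCT v₀ hB
  have hr := c'.relIndex_of_ai v₀ hS hAI hXS
  have heT := hY.2.1 he
  have heT' := hY'.2.1 he'
  have hcomm : Subgroup.Commensurable (edgeStab G e) (edgeStab G e') := by
    refine hE.comm (hET _ heT) (hET _ heT') ?_
    have h1 : HFin (edgeStab G e') (H : Set G) := HFin_of_relIndex hr
    have h2 : HFin H (edgeStab G e : Set G) := HFin_of_relIndex hHe.1
    refine relIndex_of_HFin (g := 1) ?_
    simpa using h2.trans h1
  obtain rfl : Y' = Y := by
    ext f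
    constructor
    · intro hf
      have hfT := hY'.2.1 hf
      exact (hY.2.2 e he f hfT).2 (hcomm.trans ((hY'.2.2 e' he' f hfT).1 hf))
    · intro hf
      have hfT := hY.2.1 hf
      exact (hY'.2.2 e' he' f hfT).2 (hcomm.symm.trans ((hY.2.2 e he f hfT).1 hf))
  have hHF : ∀ Z, HFin H Z ↔ HFin (edgeStab G e') Z := fun Z => Comm_HFin (hHe.trans hcomm)
  have hN : ¬ HFin (edgeStab G e') (XS G v₀ S) := by
    intro h2
    refine hAI.2.1 ((hHF _).2 ((hXS.union h2).mono fun g hg => ?_))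
    by_cases hg' : g ∈ XS G v₀ S
    · exact Or.inr hg'
    · exact Or.inl (Or.inl ⟨hg, hg'⟩)
  have hN' : ¬ HFin (edgeStab G e') (XS G v₀ Sᶜ) := by
    intro h2
    refine hAI.2.2 ((hHF _).2 ((hXS.union h2).mono fun g hg => ?_))
    by_cases hg' : g ∈ XS G v₀ S
    · exact Or.inl (Or.inr ⟨hg', hg⟩)
    · exact Or.inr hg'
  have hSC : ccRel T G v₀ X (XS G v₀ S) := hX1'.trans _ _ _ (Relation.EqvGen.rel _ _
    ⟨hX1B, c'.nontrivB v₀ hS hN hN', Or.inr ⟨H, hAI, Or.inl ((hHF _).2 hXS)⟩⟩)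
  have hSc := special_compl hS
  have hSC' := hSC.trans _ _ _ (c'.cc_compl v₀ hS hN hN')
  have hNcc : ¬ HFin (edgeStab G e') (XS G v₀ Sᶜᶜ) := by rwa [compl_compl]
  have sp := (c'.split_or_peri v₀ hS hN hu).resolve_right (by
    rintro ⟨w, hw, hfv, hf⟩
    exact hnp ⟨_, w, hY', hw, hfv,
      hSC.trans _ _ _ (c'.cc_same v₀ hS (c'.peri_special hfv) hN hN' hf)⟩)
  have spc := (c'.split_or_peri v₀ hSc hN' hu).resolve_right (by
    rintro ⟨w, hw, hfv, hf⟩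
    exact hnp ⟨_, w, hY', hw, hfv,
      hSC'.trans _ _ _ (c'.cc_same v₀ hSc (c'.peri_special hfv) hN' hNcc hf)⟩)
  obtain ⟨a, b, ha, hb, hab, hau, hav, hbu, hbv⟩ : ∃ a b, a ∈ cylBoundary T Y' ∧
      b ∈ cylBoundary T Y' ∧ a ≠ b ∧ a ≠ u ∧ a ≠ v ∧ b ≠ u ∧ b ≠ v := by
    obtain ⟨s, hs4, hs⟩ := hbig
    have h1 : 1 < (s \ {u, v}).card := by
      have := Finset.le_card_sdiff {u, v} s
      have h2 : ({u, v} : Finset V).card ≤ 2 := Finset.card_le_two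
      omega
    obtain ⟨a, ha, b, hb, hab⟩ := Finset.one_lt_card.1 h1
    simp only [Finset.mem_sdiff, Finset.mem_insert, Finset.mem_singleton, not_or] at ha hb
    exact ⟨a, b, hs ha.1, hs hb.1, hab, ha.2.1, ha.2.2, hb.2.1, hb.2.2⟩
  obtain ⟨R1, hR1, p1, q1⟩ := c'.sep hu.1 hv.1 huv
  obtain ⟨R2, hR2, p2, q2⟩ := c'.sep hu.1 hb.1 hbu.symm
  obtain ⟨R3, hR3, p3, q3⟩ := c'.sep ha.1 hv.1 hav
  obtain ⟨R4, hR4, p4, q4⟩ := c'.sep ha.1 hb.1 hab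
  obtain ⟨R5, hR5, p5, q5⟩ := c'.sep hu.1 ha.1 hau.symm
  obtain ⟨R6, hR6, p6, q6⟩ := c'.sep hv.1 hb.1 hbv.symm
  have hS' : IsSpecialForest T ((R1 ∩ R2) ∪ (R3 ∩ R4)) Y' :=
    special_union (special_inter hR1 hR2) (special_inter hR3 hR4)
  have huS : u ∈ (R1 ∩ R2) ∪ (R3 ∩ R4) := Or.inl ⟨p1, p2⟩
  have haS : a ∈ (R1 ∩ R2) ∪ (R3 ∩ R4) := Or.inr ⟨p3, p4⟩
  have hvS : v ∈ ((R1 ∩ R2) ∪ (R3 ∩ R4))ᶜ := by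
    rintro (h | h)
    · exact q1 h.1
    · exact q3 h.1
  have hbS : b ∈ ((R1 ∩ R2) ∪ (R3 ∩ R4))ᶜ := by
    rintro (h | h)
    · exact q2 h.2
    · exact q4 h.2
  refine ⟨_, hS', hSC.trans _ _ _ (c'.cc_split v₀ hS hS' sp spc ?_ ?_), huS, hvS⟩
  · exact ⟨R5, hR5, c'.N_boundary v₀ (special_inter hS' hR5) hu ⟨huS, p5⟩,
      c'.N_boundary v₀ (special_diff hS' hR5) ha ⟨haS, q5⟩⟩
  · exact ⟨R6, hR6, c'.N_boundary v₀ (special_inter (special_compl hS') hR6) hv ⟨hvS, p6⟩,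
      c'.N_boundary v₀ (special_diff (special_compl hS') hR6) hb ⟨hbS, q6⟩⟩

end SSRN
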